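/- arXiv:2507.12354 — 2 statements merged into one kernel-verified Lean document; each statement's English description precedes it below -/
import Mathlib

section
/- For every ε > 0 there exist δ > 0 and an integer N₀ such that every 𝔽-free 3-graph H on n ≥ N₀ vertices with ‖H‖₂ ≥ (1 − δ)·ex_{ℓ2}(n, 𝔽) becomes bipartite after removing at most ε·n³ edges; that is, there is a subgraph H' ⊆ H with |H \ H'| ≤ ε·n³ such that H' is bipartite. -/
/-- A 3-graph: every edge is a 3-element subset of the vertex set `Fin n`. -/
def Is3Graph {n : ℕ} (H : Finset (Finset (Fin n))) : Prop := ∀ e ∈ H, e.card = 3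

/-- The shadow of a 3-graph: the pairs contained in at least one edge. -/
def shadow3 {n : ℕ} (H : Finset (Finset (Fin n))) : Finset (Finset (Fin n)) :=
  Finset.univ.filter fun e => e.card = 2 ∧ ∃ E ∈ H, e ⊆ E

/-- The codegree of a pair `e`: the number of vertices `v` with `e ∪ {v} ∈ H`. -/
def codeg3 {n : ℕ} (H : Finset (Finset (Fin n))) (e : Finset (Fin n)) : ℕ :=
  (Finset.univ.filter fun v => v ∉ e ∧ insert v e ∈ H).card

/-- The ℓ2-norm of a 3-graph: `‖H‖₂ = ∑_{e ∈ ∂H} d_H(e)²`. -/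
def l2norm {n : ℕ} (H : Finset (Finset (Fin n))) : ℕ :=
  ∑ e ∈ shadow3 H, (codeg3 H e) ^ 2

/-- `H − v`: delete the vertex `v` and all edges containing it. -/
def delVert {n : ℕ} (H : Finset (Finset (Fin n))) (v : Fin n) : Finset (Finset (Fin n)) :=
  H.filter fun e => v ∉ e

/-- The ℓ2-norm degree of a vertex: `d_{2,H}(v) = ‖H‖₂ − ‖H − v‖₂`. -/
noncomputable def d2deg {n : ℕ} (H : Finset (Finset (Fin n))) (v : Fin n) : ℝ :=
  (l2norm H : ℝ) - (l2norm (delVert H v) : ℝ)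
/-- The edges of the Fano plane, as a 3-graph on `Fin 7` (0-indexed version of
the edge set {123, 345, 561, 174, 275, 376, 246}). -/
def fanoEdges : Finset (Finset (Fin 7)) :=
  {({0, 1, 2} : Finset (Fin 7)), {2, 3, 4}, {4, 5, 0}, {0, 6, 3}, {1, 6, 4}, {2, 6, 5}, {1, 3, 5}}

/-- A 3-graph is 𝔽-free if it contains no subgraph isomorphic to the Fano plane. -/
def FanoFree {n : ℕ} (H : Finset (Finset (Fin n))) : Prop :=
  ¬ ∃ f : Fin 7 → Fin n, Function.Injective f ∧ ∀ e ∈ fanoEdges, e.image f ∈ H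
/-- A 3-graph is bipartite if its vertex set can be partitioned into `A` and `Aᶜ` such
that every edge intersects both parts. -/
def Bipartite3 {n : ℕ} (H : Finset (Finset (Fin n))) : Prop :=
  ∃ A : Finset (Fin n), ∀ e ∈ H, (e ∩ A).Nonempty ∧ (e \ A).Nonempty
/-- `ex_{ℓ2}(n, 𝔽)`: the maximum ℓ2-norm over all 𝔽-free 3-graphs on `n` vertices. -/
noncomputable def exL2 (n : ℕ) : ℕ :=
  sSup {m : ℕ | ∃ H : Finset (Finset (Fin n)), Is3Graph H ∧ FanoFree H ∧ l2norm H = m}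


namespace FanoL2
open Finset

variable {α : Type*}

/-- The weight of a pair of multiplicity `k`. -/
def wt : ℕ → ℕ
  | 0 => 0
  | 1 => 9
  | 2 => 20
  | 3 => 29
  | _ => 40

/-- The properties of the multiplicities of pairs in the links of a `K₄³` used below. -/
structure LinkMult (m : α → α → ℕ) : Prop where
  symm : ∀ x y, m x y = m y x
  self : ∀ x, m x x = 0
  le_four : ∀ x y, m x y ≤ 4
  rainbow : ∀ x y z u, ¬ (5 ≤ m u x + m y z ∧ 6 ≤ m u y + m x z ∧ 7 ≤ m u z + m x y)
  k5 : ∀ a b c d e, ¬ (3 ≤ m a b ∧ 3 ≤ m a c ∧ 3 ≤ m a d ∧ 3 ≤ m a e ∧ 3 ≤ m b c ∧ 3 ≤ m b d ∧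
    3 ≤ m b e ∧ 3 ≤ m c d ∧ 3 ≤ m c e ∧ 3 ≤ m d e)

/-- The sum of a symmetric function over pairs after deleting a set. -/
theorem sum_pairs_le_sdiff [DecidableEq α] {f : α → α → ℝ} (hs : ∀ x y, f x y = f y x) (h0 : ∀ x y, 0 ≤ f x y)
    {U D : Finset α} (hD : D ⊆ U) :
    ∑ x ∈ U, ∑ y ∈ U, f x y ≤
      ∑ x ∈ U \ D, ∑ y ∈ U \ D, f x y + 2 * ∑ v ∈ D, ∑ u ∈ U, f v u := by
  have h1 : ∑ x ∈ U, ∑ y ∈ U, f x y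
      = ∑ x ∈ U \ D, ∑ y ∈ U \ D, f x y + ∑ x ∈ U \ D, ∑ y ∈ D, f x y
        + ∑ v ∈ D, ∑ u ∈ U, f v u := by
    rw [← sum_sdiff hD, ← sum_add_distrib]
    congr 1
    exact sum_congr rfl fun x _ => (sum_sdiff hD).symm
  have h2 : ∑ x ∈ U \ D, ∑ y ∈ D, f x y ≤ ∑ v ∈ D, ∑ u ∈ U, f v u := by
    calc ∑ x ∈ U \ D, ∑ y ∈ D, f x y ≤ ∑ x ∈ U, ∑ y ∈ D, f x y :=
          sum_le_sum_of_subset_of_nonneg sdiff_subset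
            fun x _ _ => sum_nonneg fun y _ => h0 x y
      _ = ∑ v ∈ D, ∑ u ∈ U, f v u := by
          rw [sum_comm]
          exact sum_congr rfl fun v _ => sum_congr rfl fun u _ => hs u v
  linarith

/-- The sum of a symmetric function over triples after deleting a set. -/
theorem sum_triples_le_sdiff [DecidableEq α] {g : α → α → α → ℝ} (hs : ∀ x y z, g x y z = g y x z)
    (hs' : ∀ x y z, g x y z = g x z y) (h0 : ∀ x y z, 0 ≤ g x y z)
    {U D : Finset α} (hD : D ⊆ U) :
    ∑ x ∈ U, ∑ y ∈ U, ∑ z ∈ U, g x y z ≤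
      ∑ x ∈ U \ D, ∑ y ∈ U \ D, ∑ z ∈ U \ D, g x y z
        + 3 * ∑ v ∈ D, ∑ y ∈ U, ∑ z ∈ U, g v y z := by
  have h1 := sum_pairs_le_sdiff (f := fun x y => ∑ z ∈ U, g x y z)
    (fun x y => sum_congr rfl fun z _ => hs x y z) (fun x y => sum_nonneg fun z _ => h0 x y z) hD
  have h2 : ∑ x ∈ U \ D, ∑ y ∈ U \ D, ∑ z ∈ U, g x y z
      = ∑ x ∈ U \ D, ∑ y ∈ U \ D, ∑ z ∈ U \ D, g x y z
        + ∑ x ∈ U \ D, ∑ y ∈ U \ D, ∑ z ∈ D, g x y z := by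
    simp_rw [← sum_add_distrib]
    exact sum_congr rfl fun x _ => sum_congr rfl fun y _ => (sum_sdiff hD).symm
  have h3 : ∑ x ∈ U \ D, ∑ y ∈ U \ D, ∑ z ∈ D, g x y z ≤ ∑ v ∈ D, ∑ y ∈ U, ∑ z ∈ U, g v y z := by
    calc ∑ x ∈ U \ D, ∑ y ∈ U \ D, ∑ z ∈ D, g x y z
        ≤ ∑ x ∈ U \ D, ∑ y ∈ U, ∑ z ∈ D, g x y z :=
          sum_le_sum fun x _ => sum_le_sum_of_subset_of_nonneg sdiff_subset
            fun y _ _ => sum_nonneg fun z _ => h0 x y z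
      _ ≤ ∑ x ∈ U, ∑ y ∈ U, ∑ z ∈ D, g x y z :=
          sum_le_sum_of_subset_of_nonneg sdiff_subset
            fun x _ _ => sum_nonneg fun y _ => sum_nonneg fun z _ => h0 x y z
      _ = ∑ x ∈ U, ∑ z ∈ D, ∑ y ∈ U, g z x y :=
          sum_congr rfl fun x _ => by
            rw [sum_comm]
            exact sum_congr rfl fun z _ => sum_congr rfl fun y _ => by rw [hs' x y z, hs x z y]
      _ = _ := sum_comm
  linarith

/-- The indicator of triangles with all multiplicities at least `k`. -/
def tri (m : α → α → ℕ) (k : ℕ) (x y z : α) : ℝ :=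
  if k ≤ m x y ∧ k ≤ m x z ∧ k ≤ m y z then 1 else 0

theorem tri_nonneg (m : α → α → ℕ) (k : ℕ) (x y z : α) : 0 ≤ tri m k x y z := by
  unfold tri; split_ifs <;> norm_num

/-- The functional bounding the contribution of the links of a `K₄³`. -/
def psi (m : α → α → ℕ) (n : ℝ) (U : Finset α) : ℝ :=
  n * ∑ x ∈ U, ∑ y ∈ U, (wt (m x y) : ℝ)
    + 4 * ∑ x ∈ U, ∑ y ∈ U, ∑ z ∈ U, (tri m 3 x y z + tri m 4 x y z)

theorem psi_le_sdiff [DecidableEq α] {m : α → α → ℕ} (hm : LinkMult m) {n : ℝ} (hn : 0 ≤ n)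
    {U D : Finset α} (hD : D ⊆ U) :
    psi m n U ≤ psi m n (U \ D) + (2 * n * ∑ u ∈ U, ∑ v ∈ D, (wt (m u v) : ℝ)
      + 12 * ∑ y ∈ U, ∑ z ∈ U, ∑ v ∈ D, (tri m 3 v y z + tri m 4 v y z)) := by
  have h1 := sum_pairs_le_sdiff (f := fun x y => (wt (m x y) : ℝ))
    (fun x y => by rw [hm.symm]) (fun x y => by positivity) hD
  have h2 := sum_triples_le_sdiff (g := fun x y z => tri m 3 x y z + tri m 4 x y z)
    (fun x y z => by simp only [tri, hm.symm y x]; congr 2 <;> simp only [eq_iff_iff] <;> tauto)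
    (fun x y z => by simp only [tri, hm.symm z y]; congr 2 <;> simp only [eq_iff_iff] <;> tauto)
    (fun x y z => add_nonneg (tri_nonneg ..) (tri_nonneg ..)) hD
  have h3 : ∑ y ∈ U, ∑ z ∈ U, ∑ v ∈ D, (tri m 3 v y z + tri m 4 v y z)
      = ∑ v ∈ D, ∑ y ∈ U, ∑ z ∈ U, (tri m 3 v y z + tri m 4 v y z) :=
    (sum_congr rfl fun y _ => sum_comm).trans sum_comm
  have h4 : ∑ u ∈ U, ∑ v ∈ D, (wt (m u v) : ℝ) = ∑ v ∈ D, ∑ u ∈ U, (wt (m v u) : ℝ) := by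
    rw [sum_comm]
    exact sum_congr rfl fun v _ => sum_congr rfl fun u _ => by rw [hm.symm]
  have h5 := mul_le_mul_of_nonneg_left h1 hn
  rw [h3, h4]
  unfold psi
  simp only at h2 h5
  linarith

end FanoL2

namespace FanoL2
open Finset
variable {α : Type*}

/-- No permutation of `(a, b, c)` dominates `(5, 6, 7)`. -/
def NoPerm (a b c : ℕ) : Prop :=
  ¬ (5 ≤ a ∧ 6 ≤ b ∧ 7 ≤ c) ∧ ¬ (5 ≤ a ∧ 7 ≤ b ∧ 6 ≤ c) ∧ ¬ (6 ≤ a ∧ 5 ≤ b ∧ 7 ≤ c) ∧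
  ¬ (6 ≤ a ∧ 7 ≤ b ∧ 5 ≤ c) ∧ ¬ (7 ≤ a ∧ 5 ≤ b ∧ 6 ≤ c) ∧ ¬ (7 ≤ a ∧ 6 ≤ b ∧ 5 ≤ c)

instance (a b c : ℕ) : Decidable (NoPerm a b c) := by unfold NoPerm; infer_instance

theorem NoPerm.mono {a b c a' b' c' : ℕ} (h : NoPerm a b c) (ha : a' ≤ a) (hb : b' ≤ b)
    (hc : c' ≤ c) : NoPerm a' b' c' := by
  unfold NoPerm at *; omega

namespace LinkMult
variable {m : α → α → ℕ}

theorem noPerm (hm : LinkMult m) (x y z u : α) :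
    NoPerm (m u x + m y z) (m u y + m x z) (m u z + m x y) := by
  have h1 := hm.rainbow x y z u
  have h2 := hm.rainbow x z y u
  have h3 := hm.rainbow y x z u
  have h4 := hm.rainbow y z x u
  have h5 := hm.rainbow z x y u
  have h6 := hm.rainbow z y x u
  have s1 := hm.symm z y
  have s2 := hm.symm z x
  have s3 := hm.symm y x
  unfold NoPerm
  refine ⟨?_, ?_, ?_, ?_, ?_, ?_⟩ <;> rintro ⟨g1, g2, g3⟩
  · exact h1 ⟨by omega, by omega, by omega⟩
  · exact h2 ⟨by omega, by omega, by omega⟩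
  · exact h3 ⟨by omega, by omega, by omega⟩
  · exact h5 ⟨by omega, by omega, by omega⟩
  · exact h4 ⟨by omega, by omega, by omega⟩
  · exact h6 ⟨by omega, by omega, by omega⟩

theorem noPerm_of_le (hm : LinkMult m) {x y z : α} {p q r : ℕ} (hp : p ≤ m y z) (hq : q ≤ m x z)
    (hr : r ≤ m x y) (u : α) : NoPerm (m u x + p) (m u y + q) (m u z + r) :=
  (hm.noPerm x y z u).mono (by omega) (by omega) (by omega)

theorem ne_of_pos (hm : LinkMult m) {x y : α} (h : 1 ≤ m x y) : x ≠ y := by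
  rintro rfl; rw [hm.self] at h; omega

/-- A clique of four pairs of multiplicity at least three has no pair of multiplicity four. -/
theorem not_k4_four (hm : LinkMult m) {x y z u : α} (h1 : 4 ≤ m x y) (h2 : 3 ≤ m x z)
    (h3 : 3 ≤ m y z) (h4 : 3 ≤ m u x) (h5 : 3 ≤ m u y) (h6 : 3 ≤ m u z) : False :=
  hm.rainbow x y z u ⟨by omega, by omega, by omega⟩

end LinkMult

theorem wt_le_444 {a b c : ℕ} (ha : a ≤ 4) (hb : b ≤ 4) (hc : c ≤ 4)
    (h : NoPerm (a + 4) (b + 4) (c + 4)) :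
    wt a + wt b + wt c ≤ 60 + 20 * ((if 3 ≤ a ∧ 3 ≤ b then 1 else 0)
      + (if 3 ≤ a ∧ 3 ≤ c then 1 else 0) + (if 3 ≤ b ∧ 3 ≤ c then 1 else 0)) ∧
    ((if 3 ≤ a ∧ 3 ≤ b then 1 else 0)
      + (if 3 ≤ a ∧ 3 ≤ c then 1 else 0) + (if 3 ≤ b ∧ 3 ≤ c then 1 else 0)) ≤ 1 := by
  have key : ∀ a b c : Fin 5, NoPerm (a.val + 4) (b.val + 4) (c.val + 4) →
      wt a + wt b + wt c ≤ 60 + 20 * ((if 3 ≤ a.val ∧ 3 ≤ b.val then 1 else 0)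
      + (if 3 ≤ a.val ∧ 3 ≤ c.val then 1 else 0) + (if 3 ≤ b.val ∧ 3 ≤ c.val then 1 else 0)) ∧
    ((if 3 ≤ a.val ∧ 3 ≤ b.val then 1 else 0)
      + (if 3 ≤ a.val ∧ 3 ≤ c.val then 1 else 0)
      + (if 3 ≤ b.val ∧ 3 ≤ c.val then 1 else 0)) ≤ 1 := by
    decide +kernel
  exact key ⟨a, by omega⟩ ⟨b, by omega⟩ ⟨c, by omega⟩ h

theorem wt_le_k4 {a b c d : ℕ} (ha : a ≤ 4) (hb : b ≤ 4) (hc : c ≤ 4) (hd : d ≤ 4)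
    (h1 : NoPerm (a + 3) (b + 3) (c + 3)) (h2 : NoPerm (a + 3) (b + 3) (d + 3))
    (h3 : NoPerm (a + 3) (c + 3) (d + 3)) (h4 : NoPerm (b + 3) (c + 3) (d + 3))
    (h5 : ¬ (3 ≤ a ∧ 3 ≤ b ∧ 3 ≤ c ∧ 3 ≤ d)) :
    wt a + wt b + wt c + wt d ≤ 107 := by
  have key : ∀ a b c d : Fin 5, NoPerm (a.val + 3) (b.val + 3) (c.val + 3) →
      NoPerm (a.val + 3) (b.val + 3) (d.val + 3) →
      NoPerm (a.val + 3) (c.val + 3) (d.val + 3) → NoPerm (b.val + 3) (c.val + 3) (d.val + 3) →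
      ¬ (3 ≤ a.val ∧ 3 ≤ b.val ∧ 3 ≤ c.val ∧ 3 ≤ d.val) →
      wt a + wt b + wt c + wt d ≤ 107 := by
    decide +kernel
  exact key ⟨a, by omega⟩ ⟨b, by omega⟩ ⟨c, by omega⟩ ⟨d, by omega⟩ h1 h2 h3 h4 h5

theorem wt_le_443 {a b c : ℕ} (ha : a ≤ 4) (hb : b ≤ 4) (hc : c ≤ 4)
    (h : NoPerm (a + 3) (b + 4) (c + 4)) (hab : ¬ (4 ≤ a ∧ 4 ≤ b)) (hac : ¬ (4 ≤ a ∧ 4 ≤ c)) :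
    2 * (wt a + wt b + wt c) + wt a ≤ 187 := by
  have key : ∀ a b c : Fin 5, NoPerm (a.val + 3) (b.val + 4) (c.val + 4) →
      ¬ (4 ≤ a.val ∧ 4 ≤ b.val) → ¬ (4 ≤ a.val ∧ 4 ≤ c.val) →
      2 * (wt a + wt b + wt c) + wt a ≤ 187 := by
    decide +kernel
  exact key ⟨a, by omega⟩ ⟨b, by omega⟩ ⟨c, by omega⟩ h hab hac

theorem wt_le_333 {a b c : ℕ} (ha : a ≤ 4) (hb : b ≤ 4) (hc : c ≤ 4)
    (h : NoPerm (a + 3) (b + 3) (c + 3)) (hab : ¬ (4 ≤ a ∧ 4 ≤ b)) (hac : ¬ (4 ≤ a ∧ 4 ≤ c))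
    (hbc : ¬ (4 ≤ b ∧ 4 ≤ c)) (h3 : ¬ (3 ≤ a ∧ 3 ≤ b ∧ 3 ≤ c)) :
    wt a + wt b + wt c ≤ 80 := by
  have key : ∀ a b c : Fin 5, NoPerm (a.val + 3) (b.val + 3) (c.val + 3) →
      ¬ (4 ≤ a.val ∧ 4 ≤ b.val) → ¬ (4 ≤ a.val ∧ 4 ≤ c.val) → ¬ (4 ≤ b.val ∧ 4 ≤ c.val) →
      ¬ (3 ≤ a.val ∧ 3 ≤ b.val ∧ 3 ≤ c.val) → wt a + wt b + wt c ≤ 80 := by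
    decide +kernel
  exact key ⟨a, by omega⟩ ⟨b, by omega⟩ ⟨c, by omega⟩ h hab hac hbc h3

end FanoL2

namespace FanoL2
open Finset
variable {α : Type*}

/-- The bound on the loss in `psi` when deleting `D`. -/
def loss (m : α → α → ℕ) (n : ℝ) (U D : Finset α) : ℝ :=
  2 * n * ∑ u ∈ U, ∑ v ∈ D, (wt (m u v) : ℝ)
      + 12 * ∑ y ∈ U, ∑ z ∈ U, ∑ v ∈ D, (tri m 3 v y z + tri m 4 v y z)

theorem loss_le {m : α → α → ℕ} {n : ℝ} {U D : Finset α} (hn : (#U : ℝ) ≤ n) {w t : ℝ} (ht0 : 0 ≤ t)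
    (hw : ∀ u ∈ U, ∑ v ∈ D, (wt (m u v) : ℝ) ≤ w)
    (ht : ∀ y ∈ U, ∀ z ∈ U, ∑ v ∈ D, (tri m 3 v y z + tri m 4 v y z) ≤ t) :
    loss m n U D ≤ (2 * w + 12 * t) * (n * #U) := by
  have h0 : (0 : ℝ) ≤ #U := by positivity
  have h1 : ∑ u ∈ U, ∑ v ∈ D, (wt (m u v) : ℝ) ≤ #U * w := by
    simpa using sum_le_card_nsmul U _ w hw
  have h2 : ∑ y ∈ U, ∑ z ∈ U, ∑ v ∈ D, (tri m 3 v y z + tri m 4 v y z) ≤ #U * (#U * t) := by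
    refine (sum_le_card_nsmul U _ (#U * t) fun y hy => ?_).trans (by simp)
    simpa using sum_le_card_nsmul U _ t (ht y hy)
  have h3 := mul_le_mul_of_nonneg_left h1 (by linarith : 0 ≤ 2 * n)
  have h4 : #U * (#U * t) ≤ n * (#U * t) := by gcongr
  unfold loss
  linarith

theorem tri_four_le (m : α → α → ℕ) (x y z : α) : tri m 4 x y z ≤ tri m 3 x y z := by
  unfold tri; split_ifs <;> first | (norm_num; done) | omega

theorem tri_eq_zero {m : α → α → ℕ} {k : ℕ} {x y z : α} (h : ¬ (k ≤ m x y ∧ k ≤ m x z ∧ k ≤ m y z)) :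
    tri m k x y z = 0 := if_neg h

theorem tri_le_one (m : α → α → ℕ) (k : ℕ) (x y z : α) : tri m k x y z ≤ 1 := by
  unfold tri; split_ifs <;> norm_num

/-- Two indicators that cannot both be one. -/
theorem tri_three_sum_le {m : α → α → ℕ} {x y z u v : α}
    (h1 : ¬ (3 ≤ m u v ∧ 3 ≤ m x u ∧ 3 ≤ m x v ∧ 3 ≤ m y u ∧ 3 ≤ m y v))
    (h2 : ¬ (3 ≤ m u v ∧ 3 ≤ m x u ∧ 3 ≤ m x v ∧ 3 ≤ m z u ∧ 3 ≤ m z v))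
    (h3 : ¬ (3 ≤ m u v ∧ 3 ≤ m y u ∧ 3 ≤ m y v ∧ 3 ≤ m z u ∧ 3 ≤ m z v)) :
    tri m 3 x u v + tri m 3 y u v + tri m 3 z u v ≤ 1 := by
  unfold tri
  split_ifs <;> first | (norm_num; done) | omega

variable [DecidableEq α]

theorem sum_three {f : α → ℝ} {x y z : α} (h1 : x ≠ y) (h2 : x ≠ z) (h3 : y ≠ z) :
    ∑ v ∈ ({x, y, z} : Finset α), f v = f x + f y + f z := by
  rw [sum_insert (by simp [h1, h2]), sum_insert (by simp [h3]), sum_singleton, add_assoc]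

theorem exists_loss_444 {m : α → α → ℕ} (hm : LinkMult m) {n : ℝ} {U : Finset α}
    (hn : (#U : ℝ) ≤ n) {x y z : α} (hxy : 4 ≤ m x y) (hxz : 4 ≤ m x z) (hyz : 4 ≤ m y z) :
    loss m n U {x, y, z} ≤ 178.5 * (n * #U) := by
  have n1 := hm.ne_of_pos (by omega : 1 ≤ m x y)
  have n2 := hm.ne_of_pos (by omega : 1 ≤ m x z)
  have n3 := hm.ne_of_pos (by omega : 1 ≤ m y z)
  let P : α → α → α → ℝ := fun a b u => if 3 ≤ m u a ∧ 3 ≤ m u b then 1 else 0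
  have hP0 : ∀ a b u, 0 ≤ P a b u := fun a b u => by simp only [P]; split_ifs <;> norm_num
  have hP1 : ∀ u, P x y u + P x z u + P y z u ≤ 1 := by
    intro u
    have := (wt_le_444 (hm.le_four u x) (hm.le_four u y) (hm.le_four u z)
      (hm.noPerm_of_le hyz hxz hxy u)).2
    simp only [P]
    exact_mod_cast this
  have hw : ∀ u, ∑ v ∈ ({x, y, z} : Finset α), (wt (m u v) : ℝ)
      ≤ 60 + 20 * (P x y u + P x z u + P y z u) := by
    intro u
    have := (wt_le_444 (hm.le_four u x) (hm.le_four u y) (hm.le_four u z)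
      (hm.noPerm_of_le hyz hxz hxy u)).1
    rw [sum_three n1 n2 n3]
    simp only [P]
    exact_mod_cast this
  have h3 : ∀ a b u v, 4 ≤ m a b →
      ¬ (3 ≤ m u v ∧ 3 ≤ m a u ∧ 3 ≤ m a v ∧ 3 ≤ m b u ∧ 3 ≤ m b v) := by
    rintro a b u v h ⟨g1, g2, g3, g4, g5⟩
    exact hm.not_k4_four h g2 g4 (by rwa [hm.symm v]) (by rwa [hm.symm v]) (by rwa [hm.symm v])
  have ht : ∀ u v, ∑ w ∈ ({x, y, z} : Finset α), (tri m 3 w u v + tri m 4 w u v)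
      ≤ 2 * (1 - (P x y u * P x y v + P x z u * P x z v + P y z u * P y z v)) := by
    intro u v
    have e1 : ∑ w ∈ ({x, y, z} : Finset α), (tri m 3 w u v + tri m 4 w u v)
        ≤ 2 * (tri m 3 x u v + tri m 3 y u v + tri m 3 z u v) := by
      rw [sum_three n1 n2 n3]
      linarith [tri_four_le m x u v, tri_four_le m y u v, tri_four_le m z u v]
    have e2 := tri_three_sum_le (h3 x y u v hxy) (h3 x z u v hxz) (h3 y z u v hyz)
    by_cases huv : 3 ≤ m u v
    · have key : ∀ a b, 4 ≤ m a b → P a b u * P a b v = 0 := by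
        intro a b hab
        by_contra hne
        obtain ⟨f1, f2⟩ := mul_ne_zero_iff.1 hne
        simp only [P, ne_eq, ite_eq_right_iff, one_ne_zero, imp_false, not_not] at f1 f2
        exact h3 a b u v hab ⟨huv, by rw [hm.symm a]; exact f1.1, by rw [hm.symm a]; exact f2.1,
          by rw [hm.symm b]; exact f1.2, by rw [hm.symm b]; exact f2.2⟩
      rw [key x y hxy, key x z hxz, key y z hyz]
      linarith
    · have e3 : ∀ w, tri m 3 w u v = 0 := fun w => tri_eq_zero fun h => huv h.2.2
      have f1 := hP1 u
      have f2 := hP1 v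
      have e4 := e3 x
      have e5 := e3 y
      have e6 := e3 z
      rw [e4, e5, e6] at e1
      refine e1.trans ?_
      nlinarith [mul_le_one₀ f1 (by linarith [hP0 x y v, hP0 x z v, hP0 y z v]) f2, hP0 x y u, hP0 x z u, hP0 y z u, hP0 x y v, hP0 x z v, hP0 y z v,
        mul_nonneg (hP0 x y u) (hP0 x z v), mul_nonneg (hP0 x y u) (hP0 y z v),
        mul_nonneg (hP0 x z u) (hP0 x y v), mul_nonneg (hP0 x z u) (hP0 y z v),
        mul_nonneg (hP0 y z u) (hP0 x y v), mul_nonneg (hP0 y z u) (hP0 x z v)]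
  set r : ℝ := (#U : ℝ) with hr
  set b1 := ∑ u ∈ U, P x y u with hb1
  set b2 := ∑ u ∈ U, P x z u with hb2
  set b3 := ∑ u ∈ U, P y z u with hb3
  have hb : b1 + b2 + b3 ≤ r := by
    rw [hb1, hb2, hb3, ← sum_add_distrib, ← sum_add_distrib]
    simpa using sum_le_card_nsmul U _ 1 fun u _ => hP1 u
  have c1 : 0 ≤ b1 := sum_nonneg fun u _ => hP0 ..
  have c2 : 0 ≤ b2 := sum_nonneg fun u _ => hP0 ..
  have c3 : 0 ≤ b3 := sum_nonneg fun u _ => hP0 ..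
  have s1 : ∑ u ∈ U, ∑ v ∈ ({x, y, z} : Finset α), (wt (m u v) : ℝ)
      ≤ 60 * r + 20 * (b1 + b2 + b3) := by
    refine (sum_le_sum fun u _ => hw u).trans_eq ?_
    rw [sum_add_distrib, ← mul_sum, sum_add_distrib, sum_add_distrib]
    simp [hr]; ring
  have s2 : ∑ u ∈ U, ∑ v ∈ U, ∑ w ∈ ({x, y, z} : Finset α), (tri m 3 w u v + tri m 4 w u v)
      ≤ 2 * (r ^ 2 - (b1 ^ 2 + b2 ^ 2 + b3 ^ 2)) := by
    refine (sum_le_sum fun u _ => sum_le_sum fun v _ => ht u v).trans_eq ?_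
    have : ∀ a b, (∑ u ∈ U, P a b u) ^ 2 = ∑ u ∈ U, ∑ v ∈ U, P a b u * P a b v := fun a b => by
      rw [sq, sum_mul_sum]
    rw [hb1, hb2, hb3, this, this, this]
    simp only [← mul_sum, sum_sub_distrib, sum_add_distrib]
    simp [hr, sq]
  have h4 : 0 ≤ n := by linarith [(Nat.cast_nonneg #U : (0:ℝ) ≤ #U)]
  have s3 := mul_le_mul_of_nonneg_left s1 (by linarith : 0 ≤ 2 * n)
  have hr0 : 0 ≤ r := by positivity
  set b := b1 + b2 + b3 with hbdef
  have hsq : b ^ 2 ≤ 3 * (b1 ^ 2 + b2 ^ 2 + b3 ^ 2) := by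
    rw [hbdef]; nlinarith [sq_nonneg (b1 - b2), sq_nonneg (b1 - b3), sq_nonneg (b2 - b3)]
  have hb0 : 0 ≤ b := by positivity
  have : 120 * (n * r) + 40 * n * b + 24 * r ^ 2 - 8 * b ^ 2 ≤ 178.5 * (n * r) := by
    nlinarith [mul_nonneg (sub_nonneg.2 hn) (by linarith : 0 ≤ 58.5 * r - 40 * b),
      mul_nonneg (sub_nonneg.2 hb) (by linarith : 0 ≤ 32 * r - 8 * b)]
  unfold loss
  linarith

theorem sum_four {f : α → ℝ} {x y z w : α} (h1 : x ≠ y) (h2 : x ≠ z) (h3 : x ≠ w) (h4 : y ≠ z)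
    (h5 : y ≠ w) (h6 : z ≠ w) :
    ∑ v ∈ ({x, y, z, w} : Finset α), f v = f x + f y + f z + f w := by
  rw [sum_insert (by simp [h1, h2, h3]), sum_three h4 h5 h6]; ring

theorem exists_loss_k4 {m : α → α → ℕ} (hm : LinkMult m) {n : ℝ} {U : Finset α}
    (hn : (#U : ℝ) ≤ n) (h4 : ∀ x ∈ U, ∀ y ∈ U, ∀ z ∈ U, ¬ (4 ≤ m x y ∧ 4 ≤ m x z ∧ 4 ≤ m y z))
    {x y z w : α} (hx : x ∈ U) (hy : y ∈ U) (hz : z ∈ U) (hw : w ∈ U) 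
    (hxy : 3 ≤ m x y) (hxz : 3 ≤ m x z) (hxw : 3 ≤ m x w) (hyz : 3 ≤ m y z)
    (hyw : 3 ≤ m y w) (hzw : 3 ≤ m z w) :
    loss m n U {x, y, z, w} ≤ 238 * (n * #U) := by
  have n1 := hm.ne_of_pos (by omega : 1 ≤ m x y)
  have n2 := hm.ne_of_pos (by omega : 1 ≤ m x z)
  have n3 := hm.ne_of_pos (by omega : 1 ≤ m x w)
  have n4 := hm.ne_of_pos (by omega : 1 ≤ m y z)
  have n5 := hm.ne_of_pos (by omega : 1 ≤ m y w)
  have n6 := hm.ne_of_pos (by omega : 1 ≤ m z w)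
  have := loss_le (m := m) (D := {x, y, z, w}) (w := 107) (t := 2) hn (by norm_num)
    (fun u _ => ?_) (fun u hu v hv => ?_)
  · refine this.trans_eq (by norm_num)
  · rw [sum_four n1 n2 n3 n4 n5 n6]
    have := wt_le_k4 (hm.le_four u x) (hm.le_four u y) (hm.le_four u z) (hm.le_four u w)
      (hm.noPerm_of_le hyz hxz hxy u) (hm.noPerm_of_le hyw hxw hxy u)
      (hm.noPerm_of_le hzw hxw hxz u) (hm.noPerm_of_le hzw hyw hyz u)
      (fun h => hm.k5 u x y z w ⟨h.1, h.2.1, h.2.2.1, h.2.2.2, hxy, hxz, hxw, hyz, hyw, hzw⟩)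
    exact_mod_cast this
  · have t4 : ∀ a ∈ U, tri m 4 a u v = 0 := fun a ha => tri_eq_zero (h4 a ha u hu v hv)
    have k : ∀ a b c, 3 ≤ m a b → 3 ≤ m a c → 3 ≤ m b c →
        ¬ (3 ≤ m u v ∧ 3 ≤ m a u ∧ 3 ≤ m a v ∧ 3 ≤ m b u ∧ 3 ≤ m b v ∧ 3 ≤ m c u ∧ 3 ≤ m c v) := by
      rintro a b c e1 e2 e3 ⟨g0, g1, g2, g3, g4, g5, g6⟩
      exact hm.k5 a b c u v ⟨e1, e2, g1, g2, e3, g3, g4, g5, g6, g0⟩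
    have k1 := k x y z hxy hxz hyz
    have k2 := k x y w hxy hxw hyw
    have k3 := k x z w hxz hxw hzw
    have k4 := k y z w hyz hyw hzw
    rw [sum_four n1 n2 n3 n4 n5 n6, t4 x hx, t4 y hy, t4 z hz, t4 w hw]
    unfold tri
    split_ifs <;> first | (norm_num; done) | omega

theorem exists_loss_443 {m : α → α → ℕ} (hm : LinkMult m) {n : ℝ} {U : Finset α}
    (hn : (#U : ℝ) ≤ n) (h4 : ∀ x ∈ U, ∀ y ∈ U, ∀ z ∈ U, ¬ (4 ≤ m x y ∧ 4 ≤ m x z ∧ 4 ≤ m y z))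
    (hk4 : ∀ x ∈ U, ∀ y ∈ U, ∀ z ∈ U, ∀ w ∈ U, ¬ (3 ≤ m x y ∧ 3 ≤ m x z ∧ 3 ≤ m x w ∧
      3 ≤ m y z ∧ 3 ≤ m y w ∧ 3 ≤ m z w))
    {x y z : α} (hx : x ∈ U) (hy : y ∈ U) (hz : z ∈ U)
    (hxy : 4 ≤ m x y) (hxz : 4 ≤ m x z) (hyz : 3 ≤ m y z) :
    2 * loss m n U {x, y, z} + loss m n U {x} ≤ 410 * (n * #U) := by
  have n1 := hm.ne_of_pos (by omega : 1 ≤ m x y)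
  have n2 := hm.ne_of_pos (by omega : 1 ≤ m x z)
  have n3 := hm.ne_of_pos (by omega : 1 ≤ m y z)
  have h0 : (0 : ℝ) ≤ #U := by positivity
  have s1 : 2 * ∑ u ∈ U, ∑ v ∈ ({x, y, z} : Finset α), (wt (m u v) : ℝ)
      + ∑ u ∈ U, ∑ v ∈ ({x} : Finset α), (wt (m u v) : ℝ) ≤ #U * 187 := by
    rw [mul_sum, ← sum_add_distrib]
    refine (sum_le_card_nsmul U _ 187 fun u hu => ?_).trans_eq (by simp)
    rw [sum_three n1 n2 n3, sum_singleton]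
    have := wt_le_443 (hm.le_four u x) (hm.le_four u y) (hm.le_four u z)
      (hm.noPerm_of_le hyz hxz hxy u) (fun h => h4 u hu x hx y hy ⟨h.1, h.2, hxy⟩)
      (fun h => h4 u hu x hx z hz ⟨h.1, h.2, hxz⟩)
    exact_mod_cast this
  have s2 : 2 * ∑ u ∈ U, ∑ v ∈ U, ∑ w ∈ ({x, y, z} : Finset α), (tri m 3 w u v + tri m 4 w u v)
      + ∑ u ∈ U, ∑ v ∈ U, ∑ w ∈ ({x} : Finset α), (tri m 3 w u v + tri m 4 w u v)
      ≤ (#U : ℝ) * ((#U : ℝ) * 3) := by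
    rw [mul_sum, ← sum_add_distrib]
    refine (sum_le_card_nsmul U _ ((#U : ℝ) * 3) fun u hu => ?_).trans_eq (by simp)
    rw [mul_sum, ← sum_add_distrib]
    refine (sum_le_card_nsmul U _ 3 fun v hv => ?_).trans_eq (by simp)
    have t4 : ∀ a ∈ U, tri m 4 a u v = 0 := fun a ha => tri_eq_zero (h4 a ha u hu v hv)
    have k : ∀ a ∈ U, ∀ b ∈ U, 3 ≤ m a b →
        ¬ (3 ≤ m u v ∧ 3 ≤ m a u ∧ 3 ≤ m a v ∧ 3 ≤ m b u ∧ 3 ≤ m b v) := by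
      rintro a ha b hb h ⟨g1, g2, g3, g4, g5⟩
      exact hk4 a ha b hb u hu v hv ⟨h, g2, g3, g4, g5, g1⟩
    have := tri_three_sum_le (k x hx y hy (by omega)) (k x hx z hz (by omega)) (k y hy z hz hyz)
    rw [sum_three n1 n2 n3, sum_singleton, t4 x hx, t4 y hy, t4 z hz]
    linarith [tri_le_one m 3 x u v]
  have h3 := mul_le_mul_of_nonneg_left s1 (by linarith : 0 ≤ 2 * n)
  have h4 : #U * (#U * 3 : ℝ) ≤ n * (#U * 3) := by gcongr
  unfold loss
  linarith

theorem exists_loss_333 {m : α → α → ℕ} (hm : LinkMult m) {n : ℝ} {U : Finset α}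
    (hn : (#U : ℝ) ≤ n)
    (h443 : ∀ x ∈ U, ∀ y ∈ U, ∀ z ∈ U, ¬ (4 ≤ m x y ∧ 4 ≤ m x z ∧ 3 ≤ m y z))
    (hk4 : ∀ x ∈ U, ∀ y ∈ U, ∀ z ∈ U, ∀ w ∈ U, ¬ (3 ≤ m x y ∧ 3 ≤ m x z ∧ 3 ≤ m x w ∧
      3 ≤ m y z ∧ 3 ≤ m y w ∧ 3 ≤ m z w))
    {x y z : α} (hx : x ∈ U) (hy : y ∈ U) (hz : z ∈ U)
    (hxy : 3 ≤ m x y) (hxz : 3 ≤ m x z) (hyz : 3 ≤ m y z) :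
    loss m n U {x, y, z} ≤ 172 * (n * #U) := by
  have n1 := hm.ne_of_pos (by omega : 1 ≤ m x y)
  have n2 := hm.ne_of_pos (by omega : 1 ≤ m x z)
  have n3 := hm.ne_of_pos (by omega : 1 ≤ m y z)
  have := loss_le (m := m) (D := {x, y, z}) (w := 80) (t := 1) hn (by norm_num)
    (fun u hu => ?_) (fun u hu v hv => ?_)
  · refine this.trans_eq (by norm_num)
  · rw [sum_three n1 n2 n3]
    have := wt_le_333 (hm.le_four u x) (hm.le_four u y) (hm.le_four u z)
      (hm.noPerm_of_le hyz hxz hxy u) (fun h => h443 u hu x hx y hy ⟨h.1, h.2, hxy⟩)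
      (fun h => h443 u hu x hx z hz ⟨h.1, h.2, hxz⟩) (fun h => h443 u hu y hy z hz ⟨h.1, h.2, hyz⟩)
      (fun h => hk4 u hu x hx y hy z hz ⟨h.1, h.2.1, h.2.2, hxy, hxz, hyz⟩)
    exact_mod_cast this
  · have t4 : ∀ a ∈ U, tri m 4 a u v = 0 := fun a ha => tri_eq_zero
      fun h => h443 a ha u hu v hv ⟨h.1, h.2.1, by omega⟩
    have k : ∀ a ∈ U, ∀ b ∈ U, 3 ≤ m a b →
        ¬ (3 ≤ m u v ∧ 3 ≤ m a u ∧ 3 ≤ m a v ∧ 3 ≤ m b u ∧ 3 ≤ m b v) := by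
      rintro a ha b hb h ⟨g1, g2, g3, g4, g5⟩
      exact hk4 a ha b hb u hu v hv ⟨h, g2, g3, g4, g5, g1⟩
    have := tri_three_sum_le (k x hx y hy hxy) (k x hx z hz hxz) (k y hy z hz hyz)
    rw [sum_three n1 n2 n3, t4 x hx, t4 y hy, t4 z hz]
    linarith

/-- If there is a triangle of multiplicity at least three, some small set has small loss. -/
theorem exists_loss {m : α → α → ℕ} (hm : LinkMult m) {n : ℝ} {U : Finset α}
    (hn : (#U : ℝ) ≤ n)
    (h : ∃ x ∈ U, ∃ y ∈ U, ∃ z ∈ U, 3 ≤ m x y ∧ 3 ≤ m x z ∧ 3 ≤ m y z) :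
    ∃ D ⊆ U, D.Nonempty ∧ #D ≤ 4 ∧ loss m n U D ≤ 59.5 * #D * (n * #U) := by
  have h0 : 0 ≤ n * #U := mul_nonneg (by linarith [(Nat.cast_nonneg #U : (0 : ℝ) ≤ #U)])
    (by positivity)
  have card3 : ∀ x y z, 1 ≤ m x y → 1 ≤ m x z → 1 ≤ m y z → #({x, y, z} : Finset α) = 3 :=
    fun x y z h1 h2 h3 => card_eq_three.2
      ⟨x, y, z, hm.ne_of_pos h1, hm.ne_of_pos h2, hm.ne_of_pos h3, rfl⟩
  by_cases h4 : ∃ x ∈ U, ∃ y ∈ U, ∃ z ∈ U, 4 ≤ m x y ∧ 4 ≤ m x z ∧ 4 ≤ m y z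
  · obtain ⟨x, hx, y, hy, z, hz, h1, h2, h3⟩ := h4
    have hc := card3 x y z (by omega) (by omega) (by omega)
    refine ⟨{x, y, z}, by simp [insert_subset_iff, *], by simp, by omega, ?_⟩
    rw [hc]
    exact (exists_loss_444 hm hn h1 h2 h3).trans_eq (by norm_num)
  push Not at h4
  have h4' : ∀ x ∈ U, ∀ y ∈ U, ∀ z ∈ U, ¬ (4 ≤ m x y ∧ 4 ≤ m x z ∧ 4 ≤ m y z) :=
    fun x hx y hy z hz h => absurd (h4 x hx y hy z hz h.1 h.2.1) (by omega)
  by_cases hk4 : ∀ x ∈ U, ∀ y ∈ U, ∀ z ∈ U, ∀ w ∈ U, ¬ (3 ≤ m x y ∧ 3 ≤ m x z ∧ 3 ≤ m x w ∧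
      3 ≤ m y z ∧ 3 ≤ m y w ∧ 3 ≤ m z w)
  swap
  · push Not at hk4
    obtain ⟨x, hx, y, hy, z, hz, w, hw, h1, h2, h3, h4, h5, h6⟩ := hk4
    have hc : #({x, y, z, w} : Finset α) = 4 := by
      rw [card_insert_of_notMem, card3 y z w (by omega) (by omega) (by omega)]
      have := hm.ne_of_pos (by omega : 1 ≤ m x y)
      have := hm.ne_of_pos (by omega : 1 ≤ m x z)
      have := hm.ne_of_pos (by omega : 1 ≤ m x w)
      simp [*]
    refine ⟨{x, y, z, w}, by simp [insert_subset_iff, *], by simp, by omega, ?_⟩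
    rw [hc]
    exact (exists_loss_k4 hm hn h4' hx hy hz hw h1 h2 h3 h4 h5 h6).trans_eq (by norm_num)
  by_cases h443 : ∀ x ∈ U, ∀ y ∈ U, ∀ z ∈ U, ¬ (4 ≤ m x y ∧ 4 ≤ m x z ∧ 3 ≤ m y z)
  swap
  · push Not at h443
    obtain ⟨x, hx, y, hy, z, hz, h1, h2, h3⟩ := h443
    have hc := card3 x y z (by omega) (by omega) (by omega)
    have key := exists_loss_443 hm hn h4' hk4 hx hy hz h1 h2 h3
    by_cases hs : loss m n U {x} ≤ 59.5 * (n * #U)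
    · exact ⟨{x}, by simpa using hx, by simp, by simp, by simpa using hs⟩
    · refine ⟨{x, y, z}, by simp [insert_subset_iff, *], by simp, by omega, ?_⟩
      rw [hc]
      push_cast
      linarith
  obtain ⟨x, hx, y, hy, z, hz, h1, h2, h3⟩ := h
  have hc := card3 x y z (by omega) (by omega) (by omega)
  refine ⟨{x, y, z}, by simp [insert_subset_iff, *], by simp, by omega, ?_⟩
  rw [hc]
  push_cast
  linarith [exists_loss_333 hm hn h443 hk4 hx hy hz h1 h2 h3]

/-- Deleting triangles of multiplicity at least three. -/
theorem exists_triangle_free {m : α → α → ℕ} (hm : LinkMult m) {n : ℝ} (U : Finset α)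
    (hn : (#U : ℝ) ≤ n) :
    ∃ R ⊆ U, (∀ x ∈ R, ∀ y ∈ R, ∀ z ∈ R, ¬ (3 ≤ m x y ∧ 3 ≤ m x z ∧ 3 ≤ m y z)) ∧
      psi m n U ≤ psi m n R + n * (29.75 * ((#U : ℝ) ^ 2 - (#R : ℝ) ^ 2)
        + 119 * ((#U : ℝ) - #R)) := by
  have hn0 : 0 ≤ n := by linarith [(Nat.cast_nonneg #U : (0 : ℝ) ≤ #U)]
  induction U using Finset.strongInduction with
  | H U ih =>
    by_cases h : ∃ x ∈ U, ∃ y ∈ U, ∃ z ∈ U, 3 ≤ m x y ∧ 3 ≤ m x z ∧ 3 ≤ m y z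
    · obtain ⟨D, hD, hDn, hD4, hl⟩ := exists_loss hm hn h
      have hc : #(U \ D) + #D = #U := card_sdiff_add_card_eq_card hD
      have hcr : (#(U \ D) : ℝ) + #D = #U := by exact_mod_cast hc
      have hd4 : (#D : ℝ) ≤ 4 := by exact_mod_cast hD4
      have hd0 : (0 : ℝ) ≤ #D := by positivity
      obtain ⟨R, hR, hR1, hR2⟩ := ih (U \ D) (sdiff_ssubset hD hDn) (by linarith)
      refine ⟨R, hR.trans sdiff_subset, hR1, ?_⟩
      have h1 := psi_le_sdiff hm hn0 hD
      have h2 : 59.5 * #D * (n * #U) ≤ n * (29.75 * ((#U : ℝ) ^ 2 - (#(U \ D) : ℝ) ^ 2)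
        + 119 * ((#U : ℝ) - #(U \ D))) := by
        have : (#(U \ D) : ℝ) = #U - #D := by linarith
        rw [this]
        have : 59.5 * #D * (#U : ℝ) ≤ 29.75 * ((#U : ℝ) ^ 2 - (#U - #D : ℝ) ^ 2)
          + 119 * ((#U : ℝ) - (#U - #D)) := by nlinarith
        nlinarith
      unfold loss at hl
      linarith
    · push Not at h
      exact ⟨U, Subset.rfl, fun x hx y hy z hz hh => absurd (h x hx y hy z hz hh.1 hh.2.1)
        (by omega), by simp⟩

end FanoL2

namespace FanoL2
open Finset
variable {α : Type*}

theorem wt_le (k : ℕ) : (wt k : ℝ) ≤ 20 + 20 * (if 3 ≤ k then 1 else 0) := by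
  rcases k with _ | _ | _ | _ | k <;> simp [wt] <;> norm_num

/-- The degree of `x` in `R` in the graph of pairs of multiplicity at least three. -/
def deg3 (m : α → α → ℕ) (R : Finset α) (x : α) : ℝ := ∑ y ∈ R, if 3 ≤ m x y then 1 else 0

theorem deg3_eq_card (m : α → α → ℕ) (R : Finset α) (x : α) :
    deg3 m R x = #{y ∈ R | 3 ≤ m x y} := by
  simp [deg3]

theorem exists_edge_deg3 {m : α → α → ℕ} (hm : LinkMult m) {R : Finset α}
    (he : 0 < ∑ x ∈ R, deg3 m R x) :
    ∃ x ∈ R, ∃ y ∈ R, 3 ≤ m x y ∧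
      2 * ∑ x ∈ R, deg3 m R x ≤ #R * (deg3 m R x + deg3 m R y) := by
  by_contra! hcon
  set e := ∑ x ∈ R, deg3 m R x with hedef
  have h1 : e ^ 2 ≤ #R * ∑ x ∈ R, deg3 m R x ^ 2 := sq_sum_le_card_mul_sum_sq
  have h2 : ∑ x ∈ R, ∑ y ∈ R, (if 3 ≤ m x y then 1 else 0) * (deg3 m R x + deg3 m R y)
      = 2 * ∑ x ∈ R, deg3 m R x ^ 2 := by
    have a1 : ∑ x ∈ R, ∑ y ∈ R, (if 3 ≤ m x y then (1 : ℝ) else 0) * deg3 m R x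
        = ∑ x ∈ R, deg3 m R x ^ 2 :=
      sum_congr rfl fun x _ => by rw [← sum_mul, sq]; rfl
    have a2 : ∑ x ∈ R, ∑ y ∈ R, (if 3 ≤ m x y then (1 : ℝ) else 0) * deg3 m R y
        = ∑ x ∈ R, deg3 m R x ^ 2 := by
      rw [sum_comm]
      refine sum_congr rfl fun x _ => ?_
      rw [← sum_mul, sq]
      simp only [hm.symm _ x]; rfl
    simp only [mul_add, sum_add_distrib, a1, a2]
    ring
  obtain ⟨x0, hx0, hpos⟩ := exists_lt_of_sum_lt (f := fun _ => (0 : ℝ)) (by simpa using he)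
  rw [deg3_eq_card, Nat.cast_pos, card_pos] at hpos
  obtain ⟨y0, hy0⟩ := hpos
  obtain ⟨hy0, hxy⟩ := mem_filter.1 hy0
  have h3 : ∑ x ∈ R, ∑ y ∈ R, (if 3 ≤ m x y then (1 : ℝ) else 0) * (#R * (deg3 m R x + deg3 m R y))
      < ∑ x ∈ R, ∑ y ∈ R, (if 3 ≤ m x y then (1 : ℝ) else 0) * (2 * e) := by
    have hle : ∀ x ∈ R, ∀ y ∈ R, (if 3 ≤ m x y then (1 : ℝ) else 0)
        * (#R * (deg3 m R x + deg3 m R y)) ≤ (if 3 ≤ m x y then (1 : ℝ) else 0) * (2 * e) := by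
      intro x hx y hy
      split_ifs with h
      · simpa using (hcon x hx y hy h).le
      · simp
    refine sum_lt_sum (fun x hx => sum_le_sum (hle x hx)) ⟨x0, hx0, ?_⟩
    refine sum_lt_sum (hle x0 hx0) ⟨y0, hy0, ?_⟩
    simpa [hxy] using hcon x0 hx0 y0 hy0 hxy
  have h4 : ∑ x ∈ R, ∑ y ∈ R, (if 3 ≤ m x y then (1 : ℝ) else 0) * (2 * e) = e * (2 * e) := by
    simp only [← sum_mul]; rfl
  have h5 : ∑ x ∈ R, ∑ y ∈ R, (if 3 ≤ m x y then (1 : ℝ) else 0) * (#R * (deg3 m R x + deg3 m R y))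
      = #R * (2 * ∑ x ∈ R, deg3 m R x ^ 2) := by
    rw [← h2]
    simp only [mul_sum]
    exact sum_congr rfl fun x _ => sum_congr rfl fun y _ => by ring
  rw [h4, h5] at h3
  linarith

theorem deg3_add_le [DecidableEq α] {m : α → α → ℕ} {R : Finset α}
    (hR : ∀ x ∈ R, ∀ y ∈ R, ∀ z ∈ R, ¬ (3 ≤ m x y ∧ 3 ≤ m x z ∧ 3 ≤ m y z)) {x y : α} (hx : x ∈ R)
    (hy : y ∈ R) (hxy : 3 ≤ m x y) : deg3 m R x + deg3 m R y ≤ #R := by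
  rw [deg3, deg3, ← sum_add_distrib]
  refine (sum_le_card_nsmul R _ 1 fun z hz => ?_).trans_eq (by simp)
  have := hR x hx y hy z hz
  split_ifs <;> first | (norm_num; done) | omega

theorem sum_deg3_le [DecidableEq α] {m : α → α → ℕ} (hm : LinkMult m) {R : Finset α}
    (hR : ∀ x ∈ R, ∀ y ∈ R, ∀ z ∈ R, ¬ (3 ≤ m x y ∧ 3 ≤ m x z ∧ 3 ≤ m y z)) :
    2 * ∑ x ∈ R, deg3 m R x ≤ (#R : ℝ) ^ 2 := by
  by_cases he : 0 < ∑ x ∈ R, deg3 m R x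
  · obtain ⟨x, hx, y, hy, hxy, h⟩ := exists_edge_deg3 hm he
    have := mul_le_mul_of_nonneg_left (deg3_add_le hR hx hy hxy) (Nat.cast_nonneg (α := ℝ) #R)
    linarith
  · linarith [sq_nonneg (#R : ℝ)]

theorem sum_wt_le (m : α → α → ℕ) (R : Finset α) :
    ∑ x ∈ R, ∑ y ∈ R, (wt (m x y) : ℝ) ≤ 20 * (#R : ℝ) ^ 2 + 20 * ∑ x ∈ R, deg3 m R x := by
  refine (sum_le_sum fun x _ => sum_le_sum fun y _ => wt_le (m x y)).trans_eq ?_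
  simp only [sum_add_distrib, ← mul_sum, deg3]
  simp; ring

/-- The bound on `psi` obtained from a triangle-free remainder. -/
theorem psi_le [DecidableEq α] {m : α → α → ℕ} (hm : LinkMult m) (U : Finset α) :
    ∃ R ⊆ U, (∀ x ∈ R, ∀ y ∈ R, ∀ z ∈ R, ¬ (3 ≤ m x y ∧ 3 ≤ m x z ∧ 3 ≤ m y z)) ∧
      ∑ x ∈ R, ∑ y ∈ R, (wt (m x y) : ℝ) ≤ 30 * (#R : ℝ) ^ 2 ∧
      psi m #U U ≤ #U * (∑ x ∈ R, ∑ y ∈ R, (wt (m x y) : ℝ)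
        + 29.75 * ((#U : ℝ) ^ 2 - (#R : ℝ) ^ 2) + 119 * #U) := by
  obtain ⟨R, hRU, hR, h⟩ := exists_triangle_free hm U le_rfl
  have h1 := sum_wt_le m R
  have h2 := sum_deg3_le hm hR
  refine ⟨R, hRU, hR, by linarith, h.trans ?_⟩
  have h3 : ∀ k, 3 ≤ k → ∑ x ∈ R, ∑ y ∈ R, ∑ z ∈ R, tri m k x y z = 0 := fun k hk =>
    sum_eq_zero fun x hx => sum_eq_zero fun y hy => sum_eq_zero fun z hz =>
      tri_eq_zero fun hh => hR x hx y hy z hz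
        ⟨hk.trans hh.1, hk.trans hh.2.1, hk.trans hh.2.2⟩
  have h4 : psi m #U R = #U * ∑ x ∈ R, ∑ y ∈ R, (wt (m x y) : ℝ) := by
    unfold psi
    simp only [sum_add_distrib]
    rw [h3 3 le_rfl, h3 4 (by norm_num)]
    ring
  rw [h4]
  have : (#U : ℝ) * (119 * ((#U : ℝ) - #R)) ≤ #U * (119 * #U) := by
    gcongr
    linarith [(Nat.cast_nonneg #R : (0 : ℝ) ≤ #R)]
  linarith

end FanoL2

namespace FanoL2
open Finset
variable {α : Type*}

/-- The edge predicate of a Fano-free 3-graph. -/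
structure FanoFreeSys (E : α → α → α → Bool) : Prop where
  ne : ∀ x y z, E x y z → x ≠ y
  swap : ∀ x y z, E x y z = E y x z
  swap' : ∀ x y z, E x y z = E x z y
  fano : ∀ a b c u x y z, ¬ (E a b c ∧ E a x u ∧ E a y z ∧ E b u y ∧ E b x z ∧ E c u z ∧ E c x y)

/-- A `K₄³` in a 3-graph. -/
def IsK4 (E : α → α → α → Bool) (a : Fin 4 → α) : Prop :=
  ∀ i j k, i ≠ j → i ≠ k → j ≠ k → E (a i) (a j) (a k)

/-- The set of indices `i` such that the pair `x, y` is in the link of `a i`. -/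
def colors (E : α → α → α → Bool) (a : Fin 4 → α) (x y : α) : Finset (Fin 4) :=
  {i | E (a i) x y}

/-- The multiplicity of a pair in the links of the vertices `a i`. -/
def linkMult (E : α → α → α → Bool) (a : Fin 4 → α) (x y : α) : ℕ := #(colors E a x y)

theorem exists_sdr_of_card : ∀ A B C : Finset (Fin 4), 1 ≤ #A → 2 ≤ #B → 3 ≤ #C →
    ∃ i ∈ A, ∃ j ∈ B, ∃ k ∈ C, i ≠ j ∧ i ≠ k ∧ j ≠ k := by
  intro A B C hA hB hC
  obtain ⟨i, hi⟩ := card_pos.1 (show 0 < #A by omega)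
  obtain ⟨j, hj⟩ := card_pos.1 (show 0 < #(B.erase i) by
    have := pred_card_le_card_erase (s := B) (a := i); omega)
  obtain ⟨k, hk⟩ := card_pos.1 (show 0 < #((C.erase i).erase j) by
    have := pred_card_le_card_erase (s := C) (a := i)
    have := pred_card_le_card_erase (s := C.erase i) (a := j); omega)
  simp only [mem_erase] at hj hk
  exact ⟨i, hi, j, hj.2, k, hk.2.2, hj.1.symm, hk.2.1.symm, hk.1.symm⟩

set_option synthInstance.maxHeartbeats 400000 in
set_option synthInstance.maxSize 1000 in
theorem missing_colors_of_no_sdr : ∀ p p' q q' r r' : Fin 4,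
    (∀ i j k : Fin 4, i ≠ j → i ≠ k → j ≠ k →
      ¬ (i ≠ p ∧ i ≠ p' ∧ j ≠ q ∧ j ≠ q' ∧ k ≠ r ∧ k ≠ r')) →
    p ≠ p' ∧ (q = p ∧ q' = p' ∨ q = p' ∧ q' = p) ∧ (r = p ∧ r' = p' ∨ r = p' ∧ r' = p) := by
  decide +kernel

theorem exists_missing_color {S : Finset (Fin 4)} (h : 3 ≤ #S) : ∃ c, ∀ i, i ≠ c → i ∈ S := by
  have hc : #Sᶜ ≤ 1 := by
    have := card_add_card_compl S
    rw [Fintype.card_fin] at this; omega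
  rcases Sᶜ.eq_empty_or_nonempty with h0 | ⟨c, hc'⟩
  · exact ⟨0, fun i _ => by rw [compl_eq_empty_iff] at h0; simp [h0]⟩
  · refine ⟨c, fun i hi => ?_⟩
    by_contra hS
    exact hi (card_le_one.1 hc i (mem_compl.2 hS) c hc')

theorem linkMult_linkMult {E : α → α → α → Bool} (hE : FanoFreeSys E) {a : Fin 4 → α}
    (ha : IsK4 E a) : LinkMult (linkMult E a) := by
  have csymm : ∀ x y, colors E a x y = colors E a y x := fun x y => by
    simp only [colors, hE.swap' _ x y]
  have hno : ∀ x y z u i j k, i ≠ j → i ≠ k → j ≠ k →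
      ¬ (i ∈ colors E a u x ∧ i ∈ colors E a y z ∧ j ∈ colors E a u y ∧ j ∈ colors E a x z ∧
        k ∈ colors E a u z ∧ k ∈ colors E a x y) := by
    rintro x y z u i j k hij hik hjk ⟨h1, h2, h3, h4, h5, h6⟩
    rw [csymm] at h1
    simp only [colors, mem_filter, mem_univ, true_and] at h1 h2 h3 h4 h5 h6
    exact hE.fano (a i) (a j) (a k) u x y z ⟨ha i j k hij hik hjk, h1, h2, h3, h4, h5, h6⟩
  have hinter : ∀ (A B : Finset (Fin 4)) (t : ℕ), 4 + t ≤ #A + #B → t ≤ #(A ∩ B) := by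
    intro A B t h
    have := card_union_add_card_inter A B
    have : #(A ∪ B) ≤ 4 := (card_le_univ _).trans (by simp)
    omega
  refine ⟨fun x y => by rw [linkMult, csymm, linkMult], fun x => ?_, fun x y => ?_, ?_, ?_⟩
  · rw [linkMult, card_eq_zero, eq_empty_iff_forall_notMem]
    intro i hi
    simp only [colors, mem_filter, mem_univ, true_and] at hi
    exact hE.ne x x (a i) (by rwa [hE.swap' x, hE.swap x]) rfl
  · exact (card_le_univ _).trans (by simp)
  · rintro x y z u ⟨h1, h2, h3⟩
    obtain ⟨i, hi, j, hj, k, hk, h⟩ := exists_sdr_of_card _ _ _ (hinter _ _ 1 h1) (hinter _ _ 2 h2)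
      (hinter _ _ 3 h3)
    rw [mem_inter] at hi hj hk
    exact hno x y z u i j k h.1 h.2.1 h.2.2 ⟨hi.1, hi.2, hj.1, hj.2, hk.1, hk.2⟩
  · rintro a b c d e ⟨h1, h2, h3, h4, h5, h6, h7, h8, h9, h10⟩
    obtain ⟨ab, hab⟩ := exists_missing_color h1
    obtain ⟨ac, hac⟩ := exists_missing_color h2
    obtain ⟨ad, had⟩ := exists_missing_color h3
    obtain ⟨ae, hae⟩ := exists_missing_color h4
    obtain ⟨bc, hbc⟩ := exists_missing_color h5
    obtain ⟨bd, hbd⟩ := exists_missing_color h6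
    obtain ⟨be, hbe⟩ := exists_missing_color h7
    obtain ⟨cd, hcd⟩ := exists_missing_color h8
    obtain ⟨ce, hce⟩ := exists_missing_color h9
    obtain ⟨de, hde⟩ := exists_missing_color h10
    have key : ∀ {u x y z : α} {ux yz uy xz uz xy : Fin 4},
        (∀ i, i ≠ ux → i ∈ colors E _ u x) → (∀ i, i ≠ yz → i ∈ colors E _ y z) →
        (∀ i, i ≠ uy → i ∈ colors E _ u y) → (∀ i, i ≠ xz → i ∈ colors E _ x z) →
        (∀ i, i ≠ uz → i ∈ colors E _ u z) → (∀ i, i ≠ xy → i ∈ colors E _ x y) → _ :=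
      fun {u x y z ux yz uy xz uz xy} g1 g2 g3 g4 g5 g6 =>
        missing_colors_of_no_sdr ux yz uy xz uz xy fun i j k hij hik hjk ⟨f1, f2, f3, f4, f5, f6⟩ =>
        hno x y z u i j k hij hik hjk ⟨g1 i f1, g2 i f2, g3 j f3, g4 j f4, g5 k f5, g6 k f6⟩
    have k1 := key hab hcd hac hbd had hbc
    have k2 := key hab hce hac hbe hae hbc
    have k3 := key hab hde had hbe hae hbd
    have k4 := key hac hde had hce hae hcd
    have k5 := key hbc hde hbd hce hbe hcd
    clear key hno hab hac had hae hbc hbd hbe hcd hce hde csymm hinter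
    grind

end FanoL2

namespace FanoL2
open Finset
variable {α : Type*}

/-- The indicator of an edge. -/
def ind (E : α → α → α → Bool) (x y z : α) : ℝ := if E x y z then 1 else 0

/-- The codegree of the pair `x, y` into `U`. -/
def cod (E : α → α → α → Bool) (U : Finset α) (x y : α) : ℝ := ∑ z ∈ U, ind E x y z

theorem ind_nonneg (E : α → α → α → Bool) (x y z : α) : 0 ≤ ind E x y z := by
  unfold ind; split_ifs <;> norm_num

theorem ind_le_one (E : α → α → α → Bool) (x y z : α) : ind E x y z ≤ 1 := by
  unfold ind; split_ifs <;> norm_num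

theorem cod_nonneg (E : α → α → α → Bool) (U : Finset α) (x y : α) : 0 ≤ cod E U x y :=
  sum_nonneg fun _ _ => ind_nonneg ..

theorem cod_le_card (E : α → α → α → Bool) (U : Finset α) (x y : α) : cod E U x y ≤ #U :=
  (sum_le_card_nsmul U _ 1 fun _ _ => ind_le_one ..).trans_eq (by simp)

/-- The indicator of multiplicity at least `k`. -/
def lev (m : α → α → ℕ) (k : ℕ) (x y : α) : ℝ := if k ≤ m x y then 1 else 0

theorem lev_nonneg (m : α → α → ℕ) (k : ℕ) (x y : α) : 0 ≤ lev m k x y := by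
  unfold lev; split_ifs <;> norm_num

theorem lev_le_one (m : α → α → ℕ) (k : ℕ) (x y : α) : lev m k x y ≤ 1 := by
  unfold lev; split_ifs <;> norm_num

theorem wt_add_sq_eq {m : α → α → ℕ} (hm : LinkMult m) (x y : α) :
    (wt (m x y) : ℝ) = 8 * (lev m 1 x y + lev m 2 x y) + 4 * (lev m 3 x y + lev m 4 x y)
      + (m x y : ℝ) ^ 2 := by
  have := hm.le_four x y
  unfold lev
  generalize m x y = k at *
  interval_cases k <;> norm_num [wt]

theorem min_le_sum_lev {p q : ℕ} (hp : p ≤ 4) (hq : q ≤ 4) :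
    ((min p q : ℕ) : ℝ) ≤ ∑ k ∈ ({1, 2, 3, 4} : Finset ℕ),
      (if k ≤ p then 1 else 0) * (if k ≤ q then 1 else 0) := by
  interval_cases p <;> interval_cases q <;> norm_num

theorem sum_ind_mul_le {E : α → α → α → Bool} {a : Fin 4 → α} (u y z : α) :
    ∑ i, ind E (a i) u y * ind E (a i) u z ≤
      ∑ k ∈ ({1, 2, 3, 4} : Finset ℕ), lev (linkMult E a) k u y * lev (linkMult E a) k u z := by
  have h1 : ∑ i, ind E (a i) u y * ind E (a i) u z = #(colors E a u y ∩ colors E a u z) := by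
    rw [colors, colors, ← filter_and, card_filter, Nat.cast_sum]
    refine sum_congr rfl fun i _ => ?_
    by_cases h : E (a i) u y <;> by_cases h' : E (a i) u z <;> simp [ind, h, h']
  have h2 := card_le_card (inter_subset_left (s₁ := colors E a u y) (s₂ := colors E a u z))
  have h3 := card_le_card (inter_subset_right (s₁ := colors E a u y) (s₂ := colors E a u z))
  have h4 : #(colors E a u y) ≤ 4 := (card_le_univ _).trans (by simp)
  have h5 : #(colors E a u z) ≤ 4 := (card_le_univ _).trans (by simp)
  rw [h1]
  exact (Nat.cast_le.2 (le_min h2 h3)).trans (min_le_sum_lev h4 h5)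

theorem lev_tri_le (m : α → α → ℕ) (k : ℕ) (u y z : α) :
    lev m k y z * (lev m k u y + lev m k u z) ≤ lev m k y z + tri m k u y z := by
  unfold lev tri
  split_ifs <;> first | (norm_num; done) | omega

theorem two_sum_sq_lev_le {m : α → α → ℕ} (hm : LinkMult m) (k : ℕ) (U : Finset α) :
    2 * ∑ u ∈ U, (∑ y ∈ U, lev m k u y) ^ 2 ≤
      #U * ∑ u ∈ U, ∑ y ∈ U, lev m k u y + ∑ u ∈ U, ∑ y ∈ U, ∑ z ∈ U, tri m k u y z := by
  have hs : ∀ x y, lev m k x y = lev m k y x := fun x y => by simp only [lev, hm.symm x y]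
  have h := sum_le_sum (s := U) fun u (_ : u ∈ U) => sum_le_sum (s := U) fun y (_ : y ∈ U) =>
    sum_le_sum (s := U) fun z (_ : z ∈ U) => lev_tri_le m k u y z
  simp only [mul_add, sum_add_distrib] at h
  have a1 : ∑ u ∈ U, ∑ y ∈ U, ∑ z ∈ U, lev m k y z * lev m k u y
      = ∑ u ∈ U, (∑ y ∈ U, lev m k u y) ^ 2 := by
    rw [sum_comm]
    refine sum_congr rfl fun y _ => ?_
    rw [sq, sum_mul_sum]
    exact sum_congr rfl fun u _ => sum_congr rfl fun z _ => by rw [hs u y, mul_comm]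
  have a2 : ∑ u ∈ U, ∑ y ∈ U, ∑ z ∈ U, lev m k y z * lev m k u z
      = ∑ u ∈ U, (∑ y ∈ U, lev m k u y) ^ 2 := by
    have : ∀ u ∈ U, ∑ y ∈ U, ∑ z ∈ U, lev m k y z * lev m k u z
        = ∑ z ∈ U, ∑ y ∈ U, lev m k y z * lev m k u z := fun u _ => sum_comm
    rw [sum_congr rfl this, sum_comm]
    refine sum_congr rfl fun y _ => ?_
    rw [sq, sum_mul_sum]
    exact sum_congr rfl fun u _ => sum_congr rfl fun z _ => by rw [hs u y, hs z y, mul_comm]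
  have a3 : ∑ u ∈ U, ∑ y ∈ U, ∑ z ∈ U, lev m k y z = #U * ∑ u ∈ U, ∑ y ∈ U, lev m k u y := by
    simp
  rw [a1, a2, a3] at h
  linarith

theorem sum_sq_lev_le (m : α → α → ℕ) (k : ℕ) (U : Finset α) :
    ∑ u ∈ U, (∑ y ∈ U, lev m k u y) ^ 2 ≤ #U * ∑ u ∈ U, ∑ y ∈ U, lev m k u y := by
  rw [mul_sum]
  refine sum_le_sum fun u _ => ?_
  rw [sq]
  refine mul_le_mul_of_nonneg_right ?_ (sum_nonneg fun _ _ => lev_nonneg ..)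
  exact (sum_le_card_nsmul U _ 1 fun _ _ => lev_le_one ..).trans_eq (by simp)

/-- The contribution of the links of a `K₄³` is bounded by `psi`. -/
theorem links_le_psi {E : α → α → α → Bool} {a : Fin 4 → α} (hm : LinkMult (linkMult E a))
    (U : Finset α) :
    8 * ∑ i, ∑ u ∈ U, cod E U (a i) u ^ 2
      + #U * ∑ x ∈ U, ∑ y ∈ U, (linkMult E a x y : ℝ) ^ 2 ≤ psi (linkMult E a) #U U := by
  set m := linkMult E a with hmdef
  have h1 : ∑ i, ∑ u ∈ U, cod E U (a i) u ^ 2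
      ≤ ∑ u ∈ U, (∑ y ∈ U, lev m 1 u y) ^ 2 + ∑ u ∈ U, (∑ y ∈ U, lev m 2 u y) ^ 2
       + ∑ u ∈ U, (∑ y ∈ U, lev m 3 u y) ^ 2 + ∑ u ∈ U, (∑ y ∈ U, lev m 4 u y) ^ 2 := by
    rw [sum_comm]
    simp only [← sum_add_distrib]
    refine sum_le_sum fun u _ => ?_
    have e1 : ∑ i, cod E U (a i) u ^ 2
        = ∑ y ∈ U, ∑ z ∈ U, ∑ i, ind E (a i) u y * ind E (a i) u z := by
      simp only [cod, sq, sum_mul_sum]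
      rw [sum_comm]
      exact sum_congr rfl fun y _ => sum_comm
    rw [e1]
    refine (sum_le_sum fun y _ => sum_le_sum fun z _ => sum_ind_mul_le u y z).trans_eq ?_
    rw [← hmdef]
    simp only [sq, sum_mul_sum, ← sum_add_distrib]
    refine sum_congr rfl fun y _ => sum_congr rfl fun z _ => ?_
    simp; ring
  have h2 : ∑ x ∈ U, ∑ y ∈ U, (wt (m x y) : ℝ)
      = 8 * (∑ x ∈ U, ∑ y ∈ U, lev m 1 x y + ∑ x ∈ U, ∑ y ∈ U, lev m 2 x y)
        + 4 * (∑ x ∈ U, ∑ y ∈ U, lev m 3 x y + ∑ x ∈ U, ∑ y ∈ U, lev m 4 x y)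
        + ∑ x ∈ U, ∑ y ∈ U, (m x y : ℝ) ^ 2 := by
    simp only [wt_add_sq_eq hm, sum_add_distrib, ← mul_sum]
  have h3 := sum_sq_lev_le m 1 U
  have h4 := sum_sq_lev_le m 2 U
  have h5 := two_sum_sq_lev_le hm 3 U
  have h6 := two_sum_sq_lev_le hm 4 U
  unfold psi
  rw [h2]
  simp only [sum_add_distrib]
  linarith

end FanoL2

namespace FanoL2
open Finset
variable {α : Type*}

/-- The sum of the squared codegrees over ordered pairs. -/
def nrm (E : α → α → α → Bool) (U : Finset α) : ℝ := ∑ x ∈ U, ∑ y ∈ U, cod E U x y ^ 2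

theorem IsK4.injective {E : α → α → α → Bool} (hE : FanoFreeSys E) {a : Fin 4 → α}
    (ha : IsK4 E a) : Function.Injective a := by
  intro i j h
  by_contra hij
  have : ∀ i j : Fin 4, ∃ k, i ≠ k ∧ j ≠ k := by decide
  obtain ⟨k, hik, hjk⟩ := this i j
  exact hE.ne _ _ _ (ha i j k hij hik hjk) h

variable [DecidableEq α]

theorem cod_image {E : α → α → α → Bool} (hE : FanoFreeSys E) {a : Fin 4 → α}
    (ha : IsK4 E a) (x y : α) : cod E (univ.image a) x y = linkMult E a x y := by
  rw [cod, sum_image fun i _ j _ h => ha.injective hE h, linkMult, colors, card_filter,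
    Nat.cast_sum]
  refine sum_congr rfl fun i _ => ?_
  rw [ind, hE.swap' x y, hE.swap x]
  simp

/-- Deleting a `K₄³`. -/
theorem nrm_le_delete {E : α → α → α → Bool} (hE : FanoFreeSys E) {a : Fin 4 → α}
    (ha : IsK4 E a) {U : Finset α} (haU : univ.image a ⊆ U) :
    4 * #U * nrm E U ≤ 4 * #U * nrm E (U \ univ.image a) + #U * psi (linkMult E a) #U U
      + 16 * nrm E U - ∑ x ∈ U, ∑ y ∈ U, (#U * linkMult E a x y - 4 * cod E U x y) ^ 2 := by
  set m := linkMult E a with hmdef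
  set K := univ.image a with hK
  have h1 := sum_pairs_le_sdiff (f := fun x y => cod E U x y ^ 2)
    (fun x y => by simp only [cod, ind, hE.swap x]) (fun x y => sq_nonneg _) haU
  have h2 : ∑ v ∈ K, ∑ u ∈ U, cod E U v u ^ 2 = ∑ i, ∑ u ∈ U, cod E U (a i) u ^ 2 :=
    sum_image fun i _ j _ h => ha.injective hE h
  have h3 : ∑ x ∈ U \ K, ∑ y ∈ U \ K, cod E U x y ^ 2
      ≤ nrm E (U \ K) + 2 * ∑ x ∈ U, ∑ y ∈ U, (m x y : ℝ) * cod E U x y := by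
    have e1 : ∑ x ∈ U \ K, ∑ y ∈ U \ K, (m x y : ℝ) * cod E U x y
        ≤ ∑ x ∈ U, ∑ y ∈ U, (m x y : ℝ) * cod E U x y := by
      have h0 : ∀ x y, 0 ≤ (m x y : ℝ) * cod E U x y := fun x y =>
        mul_nonneg (by positivity) (cod_nonneg ..)
      exact (sum_le_sum fun x _ => sum_le_sum_of_subset_of_nonneg sdiff_subset
        fun y _ _ => h0 x y).trans (sum_le_sum_of_subset_of_nonneg sdiff_subset
          fun x _ _ => sum_nonneg fun y _ => h0 x y)
    refine le_trans ?_ (add_le_add le_rfl (mul_le_mul_of_nonneg_left e1 zero_le_two))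
    rw [nrm, mul_sum, ← sum_add_distrib]
    refine sum_le_sum fun x _ => ?_
    rw [mul_sum, ← sum_add_distrib]
    refine sum_le_sum fun y _ => ?_
    have e2 : cod E U x y = cod E (U \ K) x y + m x y := by
      rw [hmdef, ← cod_image hE ha, cod, cod, cod, sum_sdiff haU]
    rw [e2]
    nlinarith [cod_nonneg E (U \ K) x y, sq_nonneg (m x y : ℝ)]
  have h4 := links_le_psi (linkMult_linkMult hE ha) U
  have h5 : ∑ x ∈ U, ∑ y ∈ U, (#U * (m x y : ℝ) - 4 * cod E U x y) ^ 2
      = #U ^ 2 * ∑ x ∈ U, ∑ y ∈ U, (m x y : ℝ) ^ 2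
        - 8 * #U * ∑ x ∈ U, ∑ y ∈ U, (m x y : ℝ) * cod E U x y + 16 * nrm E U := by
    simp only [nrm, mul_sum, ← sum_sub_distrib, ← sum_add_distrib]
    exact sum_congr rfl fun x _ => sum_congr rfl fun y _ => by ring
  have h6 : nrm E U ≤ nrm E (U \ K) + 2 * ∑ x ∈ U, ∑ y ∈ U, (m x y : ℝ) * cod E U x y
      + 2 * ∑ i, ∑ u ∈ U, cod E U (a i) u ^ 2 := by
    rw [h2] at h1
    exact h1.trans (by linarith)
  have h7 := mul_le_mul_of_nonneg_left h6 (by positivity : (0 : ℝ) ≤ 4 * #U)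
  have h8 := mul_le_mul_of_nonneg_left h4 (by positivity : (0 : ℝ) ≤ #U)
  rw [h5]
  linarith

/-- Either deleting a `K₄³` loses little, or the links are close to extremal. -/
theorem delete_dichotomy {E : α → α → α → Bool} (hE : FanoFreeSys E) {a : Fin 4 → α}
    (ha : IsK4 E a) {U : Finset α} (haU : univ.image a ⊆ U) (η : ℝ) :
    (#U - 4) * nrm E U ≤ #U * nrm E (U \ univ.image a) + (7.5 - η) * #U ^ 4 + 30 * #U ^ 3 ∨
    ((#U - 4) * nrm E U ≤ #U * nrm E (U \ univ.image a) + 7.5 * #U ^ 4 + 30 * #U ^ 3 ∧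
      ∑ x ∈ U, ∑ y ∈ U, (#U * linkMult E a x y - 4 * cod E U x y) ^ 2 ≤ 4 * η * #U ^ 4 ∧
      ∃ R ⊆ U, (∀ x ∈ R, ∀ y ∈ R, ∀ z ∈ R, ¬ (3 ≤ linkMult E a x y ∧ 3 ≤ linkMult E a x z ∧
        3 ≤ linkMult E a y z)) ∧ (#U : ℝ) ^ 2 - #R ^ 2 ≤ 16 * η * #U ^ 2 ∧
        30 * (#R : ℝ) ^ 2 - 4 * η * #U ^ 2 ≤ ∑ x ∈ R, ∑ y ∈ R, (wt (linkMult E a x y) : ℝ)) := by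
  have h1 := nrm_le_delete hE ha haU
  obtain ⟨R, hRU, hR, hW, h2⟩ := psi_le (linkMult_linkMult hE ha) U
  set Q := ∑ x ∈ U, ∑ y ∈ U, (#U * linkMult E a x y - 4 * cod E U x y) ^ 2 with hQ
  set W := ∑ x ∈ R, ∑ y ∈ R, (wt (linkMult E a x y) : ℝ)
  have hQ0 : 0 ≤ Q := sum_nonneg fun _ _ => sum_nonneg fun _ _ => sq_nonneg _
  have hRU' : (#R : ℝ) ≤ #U := by exact_mod_cast card_le_card hRU
  have hr0 : (0 : ℝ) ≤ #R := by positivity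
  have hn0 : (0 : ℝ) < #U := by
    have : #(univ.image a) ≤ #U := card_le_card haU
    rw [card_image_of_injective _ (ha.injective hE)] at this
    simp at this
    exact_mod_cast (by omega : 0 < #U)
  set n : ℝ := (#U : ℝ)
  set ρ : ℝ := (#R : ℝ)
  have hσ : 0 ≤ n ^ 2 - ρ ^ 2 := by nlinarith
  have h3 := mul_le_mul_of_nonneg_left h2 hn0.le
  have hn2 : 0 < n ^ 2 := by positivity
  by_cases hc : 4 * η * n ^ 4 ≤ n ^ 2 * (0.25 * (n ^ 2 - ρ ^ 2) + (30 * ρ ^ 2 - W)) + Q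
  · left
    have : 0 ≤ n ^ 3 := by positivity
    nlinarith
  · right
    push Not at hc
    have e1 : 0 ≤ n ^ 2 * (n ^ 2 - ρ ^ 2) := by positivity
    have e2 : 0 ≤ n ^ 2 * (30 * ρ ^ 2 - W) := mul_nonneg hn2.le (by linarith)
    refine ⟨?_, by linarith, R, hRU, hR, ?_, ?_⟩
    · have : 0 ≤ n ^ 3 := by positivity
      nlinarith
    · refine le_of_mul_le_mul_left ?_ hn2
      linarith
    · have : n ^ 2 * (30 * ρ ^ 2 - 4 * η * n ^ 2) ≤ n ^ 2 * W := by linarith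
      exact le_of_mul_le_mul_left this hn2

end FanoL2

namespace FanoL2
open Finset
variable {α : Type*}

theorem sum_sum_le_of_subset {f : α → α → ℝ} (h0 : ∀ x y, 0 ≤ f x y) {A B U V : Finset α}
    (hA : A ⊆ U) (hB : B ⊆ V) : ∑ x ∈ A, ∑ y ∈ B, f x y ≤ ∑ x ∈ U, ∑ y ∈ V, f x y :=
  (sum_le_sum fun x _ => sum_le_sum_of_subset_of_nonneg hB fun y _ _ => h0 x y).trans
    (sum_le_sum_of_subset_of_nonneg hA fun x _ _ => sum_nonneg fun y _ => h0 x y)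

variable [DecidableEq α]

/-- `U` has a partition with few edges inside the parts, up to a few vertices. -/
def AlmostBip (E : α → α → α → Bool) (κ : ℝ) (U : Finset α) : Prop :=
  ∃ X ⊆ U, ∃ Y ⊆ U, Disjoint X Y ∧
    ∑ x ∈ X, ∑ y ∈ X, cod E X x y + ∑ x ∈ Y, ∑ y ∈ Y, cod E Y x y
      + #(U \ (X ∪ Y)) * (#U : ℝ) ^ 2 ≤ κ * #U ^ 3

/-- Few edges lie inside a part that has multiplicity at most two inside and mostly four across. -/
theorem sum_cod_le {E : α → α → α → Bool} (hE : FanoFreeSys E) {m : α → α → ℕ}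
    {U X Y : Finset α} (hX : X ⊆ U) (hY : Y ⊆ U) (hXY : Disjoint X Y) {A B b : ℝ}
    (hA : ∑ x ∈ U, ∑ y ∈ U, |#U * (m x y : ℝ) - 4 * cod E U x y| ≤ A)
    (hX2 : ∀ x ∈ X, ∀ y ∈ X, m x y ≤ 2)
    (hB : ∑ x ∈ X, ∑ y ∈ Y, (4 - m x y : ℝ) ≤ B) (hb : (#U : ℝ) - 2 * #Y ≤ b) (hb0 : 0 ≤ b) :
    4 * ∑ x ∈ X, ∑ y ∈ X, cod E X x y ≤ 2 * A + #U * B + 2 * b * #U ^ 2 := by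
  set n : ℝ := (#U : ℝ)
  have habs : ∀ x y, 0 ≤ |n * (m x y : ℝ) - 4 * cod E U x y| := fun x y => abs_nonneg _
  have h1 : 4 * ∑ x ∈ X, ∑ y ∈ X, cod E U x y ≤ 2 * n * #X ^ 2 + A := by
    refine le_trans ?_ (add_le_add le_rfl ((sum_sum_le_of_subset habs hX hX).trans hA))
    have : 2 * n * (#X : ℝ) ^ 2 = ∑ x ∈ X, ∑ y ∈ X, 2 * n := by simp; ring
    rw [this, mul_sum, ← sum_add_distrib]
    refine sum_le_sum fun x hx => ?_
    rw [mul_sum, ← sum_add_distrib]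
    refine sum_le_sum fun y hy => ?_
    have e1 : (m x y : ℝ) ≤ 2 := by exact_mod_cast hX2 x hx y hy
    have e2 : n * (m x y : ℝ) ≤ n * 2 := by gcongr
    linarith [neg_abs_le (n * (m x y : ℝ) - 4 * cod E U x y)]
  have h2 : ∑ x ∈ X, ∑ y ∈ Y, (4 * n - 4 * cod E U x y) ≤ n * B + A := by
    refine le_trans ?_ (add_le_add (mul_le_mul_of_nonneg_left hB (Nat.cast_nonneg _))
      ((sum_sum_le_of_subset habs hX hY).trans hA))
    rw [mul_sum, ← sum_add_distrib]
    refine sum_le_sum fun x hx => ?_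
    rw [mul_sum, ← sum_add_distrib]
    refine sum_le_sum fun y hy => ?_
    linarith [le_abs_self (n * (m x y : ℝ) - 4 * cod E U x y)]
  have h3 : ∑ x ∈ X, ∑ y ∈ Y, (#X - cod E X x y) ≤ ∑ x ∈ X, ∑ y ∈ Y, (n - cod E U x y) := by
    refine sum_le_sum fun x _ => sum_le_sum fun y _ => ?_
    have e1 : ∀ V : Finset α, (#V : ℝ) - cod E V x y = ∑ z ∈ V, (1 - ind E x y z) := fun V => by
      rw [sum_sub_distrib, cod]; simp
    rw [e1, e1]
    exact sum_le_sum_of_subset_of_nonneg hX fun z _ _ => by linarith [ind_le_one E x y z]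
  have h4 : ∑ x ∈ X, ∑ y ∈ Y, (#X - cod E X x y)
      = (#X : ℝ) ^ 2 * #Y - ∑ x ∈ X, ∑ y ∈ X, cod E Y x y := by
    have : ∀ x, ∑ y ∈ Y, cod E X x y = ∑ y ∈ X, cod E Y x y := fun x => by
      simp only [cod]
      rw [sum_comm]
      exact sum_congr rfl fun y _ => sum_congr rfl fun z _ => by rw [ind, hE.swap', ind]
    simp only [sum_sub_distrib, this]
    simp; ring
  have h5 : ∑ x ∈ X, ∑ y ∈ X, cod E X x y + ∑ x ∈ X, ∑ y ∈ X, cod E Y x y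
      ≤ ∑ x ∈ X, ∑ y ∈ X, cod E U x y := by
    simp only [← sum_add_distrib]
    refine sum_le_sum fun x _ => sum_le_sum fun y _ => ?_
    rw [cod, cod, ← sum_union hXY]
    exact sum_le_sum_of_subset_of_nonneg (union_subset hX hY) fun _ _ _ => ind_nonneg ..
  have h6 : ∑ x ∈ X, ∑ y ∈ Y, (4 * n - 4 * cod E U x y)
      = 4 * ∑ x ∈ X, ∑ y ∈ Y, (n - cod E U x y) := by
    simp only [← mul_sub, ← mul_sum]
  have h7 : (#X : ℝ) ≤ n := Nat.cast_le.2 (card_le_card hX)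
  have h8 : (#X : ℝ) ^ 2 * (n - 2 * #Y) ≤ n ^ 2 * b := by
    have : (#X : ℝ) ^ 2 ≤ n ^ 2 := by gcongr
    nlinarith [sq_nonneg (#X : ℝ)]
  linarith

theorem ten_mul_le_wt {k : ℕ} : (10 : ℝ) * (4 - k) ≤ 40 - wt k := by
  rcases k with _ | _ | _ | _ | k <;> simp [wt] <;> norm_num
  linarith [(Nat.cast_nonneg k : (0 : ℝ) ≤ k)]

theorem wt_le_forty (k : ℕ) : (wt k : ℝ) ≤ 40 := by
  rcases k with _ | _ | _ | _ | k <;> simp [wt] <;> norm_num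

set_option maxHeartbeats 1000000 in
/-- Links close to extremal force an almost bipartite structure. -/
theorem almostBip_of_close {E : α → α → α → Bool} (hE : FanoFreeSys E) {m : α → α → ℕ}
    (hm : LinkMult m) {U R : Finset α} (hU : U.Nonempty) {θ : ℝ} (hθ : 0 < θ) (hθ1 : θ ≤ 0.05)
    (hQ : ∑ x ∈ U, ∑ y ∈ U, (#U * (m x y : ℝ) - 4 * cod E U x y) ^ 2 ≤ 4 * θ ^ 2 * #U ^ 4)
    (hRU : R ⊆ U)
    (hR : ∀ x ∈ R, ∀ y ∈ R, ∀ z ∈ R, ¬ (3 ≤ m x y ∧ 3 ≤ m x z ∧ 3 ≤ m y z))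
    (hρ : (#U : ℝ) ^ 2 - #R ^ 2 ≤ 16 * θ ^ 2 * #U ^ 2)
    (hW : 30 * (#R : ℝ) ^ 2 - 4 * θ ^ 2 * #U ^ 2 ≤ ∑ x ∈ R, ∑ y ∈ R, (wt (m x y) : ℝ)) :
    AlmostBip E (11 * θ) U := by
  have hn0 : (0 : ℝ) < #U := by exact_mod_cast hU.card_pos
  have hRU' : (#R : ℝ) ≤ #U := by exact_mod_cast card_le_card hRU
  have hWle := sum_wt_le m R
  set n : ℝ := (#U : ℝ) with hn
  set ρ : ℝ := (#R : ℝ) with hρdef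
  have hρ0 : 0 ≤ ρ := by positivity
  have hn2 : 0 < n ^ 2 := by positivity
  have hη : θ ^ 2 ≤ 0.0025 := by nlinarith
  have hηθ : θ ^ 2 ≤ 0.05 * θ := by nlinarith
  have hηn : θ ^ 2 * n ^ 2 ≤ 0.0025 * n ^ 2 := by gcongr
  obtain ⟨x, hx, y, hy, hxy, hs⟩ := exists_edge_deg3 hm (R := R) (by linarith)
  have hsle := deg3_add_le hR hx hy hxy
  set X := {v ∈ R | 3 ≤ m y v} with hXdef
  set Y := {v ∈ R | 3 ≤ m x v} with hYdef
  have hXR : X ⊆ R := filter_subset _ _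
  have hYR : Y ⊆ R := filter_subset _ _
  have hXY : Disjoint X Y := by
    rw [disjoint_left]
    intro v hv hv'
    rw [mem_filter] at hv hv'
    exact hR x hx y hy v hv.1 ⟨hxy, hv'.2, hv.2⟩
  have hX2 : ∀ u ∈ X, ∀ v ∈ X, m u v ≤ 2 := by
    intro u hu v hv
    rw [mem_filter] at hu hv
    by_contra h
    exact hR y hy u hu.1 v hv.1 ⟨hu.2, hv.2, by omega⟩
  have hY2 : ∀ u ∈ Y, ∀ v ∈ Y, m u v ≤ 2 := by
    intro u hu v hv
    rw [mem_filter] at hu hv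
    by_contra h
    exact hR x hx u hu.1 v hv.1 ⟨hu.2, hv.2, by omega⟩
  rw [deg3_eq_card m R x, deg3_eq_card m R y] at hs hsle
  change (#Y : ℝ) + #X ≤ ρ at hsle
  change 2 * ∑ x ∈ R, deg3 m R x ≤ ρ * ((#Y : ℝ) + #X) at hs
  set a : ℝ := (#X : ℝ) with ha
  set b : ℝ := (#Y : ℝ) with hb
  have ha0 : 0 ≤ a := by positivity
  have hb0 : 0 ≤ b := by positivity
  have hs1 : (1 - 16.4 * θ ^ 2) * n ≤ a + b := by
    have : n * ((1 - 16.4 * θ ^ 2) * n) ≤ n * (a + b) := by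
      have : ρ * (b + a) ≤ n * (a + b) := by
        rw [add_comm b a]; gcongr
      linarith
    exact le_of_mul_le_mul_left this hn0
  have hs0 : 0 ≤ (1 - 16.4 * θ ^ 2) * n := mul_nonneg (by linarith) hn0.le
  have hssq : (1 - 32.8 * θ ^ 2) * n ^ 2 ≤ (a + b) ^ 2 := by
    have e1 : ((1 - 16.4 * θ ^ 2) * n) ^ 2 ≤ (a + b) ^ 2 := by gcongr
    nlinarith [mul_nonneg (sq_nonneg (θ ^ 2)) hn2.le]
  set Δ := ∑ u ∈ X, ∑ v ∈ Y, (40 - wt (m u v) : ℝ) with hΔ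
  have hsplit : 20 * a ^ 2 + 20 * b ^ 2 + 2 * Δ ≤ 10 * ρ ^ 2 + 4 * θ ^ 2 * n ^ 2 := by
    have e0 : ∀ u v, 0 ≤ (40 - wt (m u v) : ℝ) := fun u v => by linarith [wt_le_forty (m u v)]
    have e1 := sum_sum_le_of_subset e0 (union_subset hXR hYR) (union_subset hXR hYR)
    have e2 : ∀ V : Finset α, (∀ u ∈ V, ∀ v ∈ V, m u v ≤ 2) →
        20 * (#V : ℝ) ^ 2 ≤ ∑ u ∈ V, ∑ v ∈ V, (40 - wt (m u v) : ℝ) := by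
      intro V hV
      have : 20 * (#V : ℝ) ^ 2 = ∑ u ∈ V, ∑ v ∈ V, (20 : ℝ) := by simp; ring
      rw [this]
      refine sum_le_sum fun u hu => sum_le_sum fun v hv => ?_
      have := hV u hu v hv
      have h20 := wt_le (m u v)
      rw [if_neg (by omega)] at h20
      linarith
    have e3 : ∑ u ∈ Y, ∑ v ∈ X, (40 - wt (m u v) : ℝ) = Δ := by
      rw [sum_comm]
      exact sum_congr rfl fun u _ => sum_congr rfl fun v _ => by rw [hm.symm]
    have e4 : ∑ u ∈ R, ∑ v ∈ R, (40 - wt (m u v) : ℝ)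
        = 40 * ρ ^ 2 - ∑ x ∈ R, ∑ y ∈ R, (wt (m x y) : ℝ) := by
      simp only [sum_sub_distrib]
      simp; ring
    rw [e4, sum_union hXY] at e1
    simp only [sum_union hXY, sum_add_distrib] at e1
    rw [e3] at e1
    linarith [e2 X hX2, e2 Y hY2]
  have hρn : ρ ^ 2 ≤ n ^ 2 := by gcongr
  have hΔ0 : 0 ≤ Δ := sum_nonneg fun u _ => sum_nonneg fun v _ => by
    linarith [wt_le_forty (m u v)]
  have hq : 20 * a ^ 2 + 20 * b ^ 2 = 10 * (a + b) ^ 2 + 10 * (a - b) ^ 2 := by ring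
  have hΔ1 : Δ ≤ 166 * θ ^ 2 * n ^ 2 := by linarith [sq_nonneg (a - b)]
  have hab : (a - b) ^ 2 ≤ (6 * θ * n) ^ 2 := by
    have e1 : (6 * θ * n) ^ 2 = 36 * (θ ^ 2 * n ^ 2) := by ring
    have e2 : 0 ≤ θ ^ 2 * n ^ 2 := by positivity
    linarith
  have hab' := abs_le.1 (abs_le_of_sq_le_sq hab (by positivity))
  have hθn : θ ^ 2 * n ≤ 0.05 * θ * n := by gcongr
  have hA : ∑ x ∈ U, ∑ y ∈ U, |n * (m x y : ℝ) - 4 * cod E U x y| ≤ 2 * θ * n ^ 3 := by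
    have e1 : ∀ t : ℝ, 4 * θ * n * |t| ≤ t ^ 2 + 4 * θ ^ 2 * n ^ 2 := fun t => by
      nlinarith [sq_nonneg (|t| - 2 * θ * n), sq_abs t]
    have e2 := sum_le_sum (s := U) fun x (_ : x ∈ U) => sum_le_sum (s := U) fun y (_ : y ∈ U) =>
      e1 (n * (m x y : ℝ) - 4 * cod E U x y)
    simp only [sum_add_distrib, ← mul_sum] at e2
    have e3 : ∑ x ∈ U, ∑ y ∈ U, n ^ 2 = n ^ 4 := by
      simp [← hn]; ring
    rw [e3] at e2
    have : 4 * θ * n * ∑ x ∈ U, ∑ y ∈ U, |n * (m x y : ℝ) - 4 * cod E U x y|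
      ≤ 4 * θ * n * (2 * θ * n ^ 3) := by linarith
    exact le_of_mul_le_mul_left this (by positivity)
  have hB : ∑ u ∈ X, ∑ v ∈ Y, (4 - m u v : ℝ) ≤ 16.6 * θ ^ 2 * n ^ 2 := by
    have : 10 * ∑ u ∈ X, ∑ v ∈ Y, (4 - m u v : ℝ) ≤ Δ := by
      rw [mul_sum]
      refine sum_le_sum fun u _ => ?_
      rw [mul_sum]
      exact sum_le_sum fun v _ => ten_mul_le_wt
    linarith
  have hB' : ∑ u ∈ Y, ∑ v ∈ X, (4 - m u v : ℝ) ≤ 16.6 * θ ^ 2 * n ^ 2 := by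
    refine le_trans (le_of_eq ?_) hB
    rw [sum_comm]
    exact sum_congr rfl fun u _ => sum_congr rfl fun v _ => by rw [hm.symm]
  have k1 := sum_cod_le hE (hXR.trans hRU) (hYR.trans hRU) hXY hA hX2 hB
    (b := 7 * θ * n) (by linarith) (by positivity)
  have k2 := sum_cod_le hE (hYR.trans hRU) (hXR.trans hRU) hXY.symm hA hY2 hB'
    (b := 7 * θ * n) (by linarith) (by positivity)
  refine ⟨X, hXR.trans hRU, Y, hYR.trans hRU, hXY, ?_⟩
  have hz : (#(U \ (X ∪ Y)) : ℝ) = n - (a + b) := by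
    have h1 := card_sdiff_add_card_eq_card (union_subset (hXR.trans hRU) (hYR.trans hRU))
    rw [card_union_of_disjoint hXY] at h1
    have : (#(U \ (X ∪ Y)) : ℝ) + (#X + #Y) = #U := by exact_mod_cast h1
    linarith
  rw [hz]
  have hz' : (n - (a + b)) * n ^ 2 ≤ (0.82 * θ * n) * n ^ 2 := by
    gcongr; linarith
  have h3 : θ ^ 2 * n ^ 3 ≤ 0.05 * θ * n ^ 3 := by gcongr
  linarith [mul_pos hθ (pow_pos hn0 3)]

end FanoL2

namespace FanoL2
open Finset
variable {α : Type*}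

theorem isK4_of_edges {E : α → α → α → Bool} (hE : FanoFreeSys E) {x y z w : α} (h1 : E x y z)
    (h2 : E x y w) (h3 : E x z w) (h4 : E y z w) : IsK4 E ![x, y, z, w] := by
  have p : ∀ {x y z}, E x y z → E x z y = true ∧ E y x z = true ∧ E y z x = true ∧
      E z x y = true ∧ E z y x = true := by
    intro x y z h
    have a1 := hE.swap x y z
    have a2 := hE.swap' x y z
    have a3 := hE.swap' y x z
    have a4 := hE.swap x z y
    have a5 := hE.swap' z x y
    refine ⟨?_, ?_, ?_, ?_, ?_⟩ <;> grind
  obtain ⟨p1, p2, p3, p4, p5⟩ := p h1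
  obtain ⟨q1, q2, q3, q4, q5⟩ := p h2
  obtain ⟨r1, r2, r3, r4, r5⟩ := p h3
  obtain ⟨s1, s2, s3, s4, s5⟩ := p h4
  intro i j k hij hik hjk
  fin_cases i <;> fin_cases j <;> fin_cases k <;> first | assumption | exact absurd rfl ‹_›

theorem nrm_nonneg (E : α → α → α → Bool) (U : Finset α) : 0 ≤ nrm E U :=
  sum_nonneg fun _ _ => sum_nonneg fun _ _ => sq_nonneg _

theorem nrm_le_pow (E : α → α → α → Bool) (U : Finset α) : nrm E U ≤ (#U : ℝ) ^ 4 := by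
  have : (#U : ℝ) ^ 4 = ∑ x ∈ U, ∑ y ∈ U, (#U : ℝ) ^ 2 := by simp; ring
  rw [this]
  refine sum_le_sum fun x _ => sum_le_sum fun y _ => ?_
  have := cod_nonneg E U x y
  have := cod_le_card E U x y
  gcongr

variable [DecidableEq α]

/-- The norm of a `K₄³`-free 3-graph. -/
theorem nrm_le_of_no_k4 {E : α → α → α → Bool} (hE : FanoFreeSys E) {U : Finset α}
    (h : ∀ a : Fin 4 → α, univ.image a ⊆ U → ¬ IsK4 E a) : nrm E U ≤ 4 / 9 * (#U : ℝ) ^ 4 := by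
  have hs : ∀ x y, cod E U x y = cod E U y x := fun x y => by simp only [cod, ind, hE.swap x y]
  have hi : ∀ x y z, ind E x y z = ind E y x z := fun x y z => by simp only [ind, hE.swap x y]
  have hi' : ∀ x y z, ind E x y z = ind E x z y := fun x y z => by simp only [ind, hE.swap' x y]
  have key : ∀ x ∈ U, ∀ y ∈ U, ∀ z ∈ U,
      ind E x y z * (cod E U x y + cod E U x z + cod E U y z) ≤ ind E x y z * (2 * #U) := by
    intro x hx y hy z hz
    by_cases hxyz : E x y z
    · refine mul_le_mul_of_nonneg_left ?_ (ind_nonneg ..)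
      rw [cod, cod, cod, ← sum_add_distrib, ← sum_add_distrib]
      refine (sum_le_card_nsmul U _ 2 fun w hw => ?_).trans_eq (by simp; ring)
      have : ¬ (E x y w ∧ E x z w ∧ E y z w) := by
        rintro ⟨h1, h2, h3⟩
        refine h ![x, y, z, w] ?_ (isK4_of_edges hE hxyz h1 h2 h3)
        intro v hv
        obtain ⟨i, -, rfl⟩ := mem_image.1 hv
        fin_cases i <;> simp [*]
      unfold ind
      split_ifs <;> first | (norm_num; done) | tauto
    · simp [ind, hxyz]
  have h1 := sum_le_sum fun x hx => sum_le_sum fun y hy => sum_le_sum fun z hz => key x hx y hy z hz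
  simp only [mul_add, sum_add_distrib, ← sum_mul] at h1
  have e1 : ∑ x ∈ U, ∑ y ∈ U, (∑ z ∈ U, ind E x y z) * cod E U x y = nrm E U :=
    sum_congr rfl fun x _ => sum_congr rfl fun y _ => by rw [sq]; rfl
  have e2 : ∑ x ∈ U, ∑ y ∈ U, ∑ z ∈ U, ind E x y z * cod E U x z = nrm E U := by
    rw [← e1]
    refine sum_congr rfl fun x _ => ?_
    rw [sum_comm]
    refine sum_congr rfl fun z _ => ?_
    rw [← sum_mul]
    exact congrArg (· * _) (sum_congr rfl fun y _ => hi' x y z)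
  have e3 : ∑ x ∈ U, ∑ y ∈ U, ∑ z ∈ U, ind E x y z * cod E U y z = nrm E U := by
    rw [← e2, sum_comm]
    refine sum_congr rfl fun y _ => sum_congr rfl fun x _ => sum_congr rfl fun z _ => ?_
    rw [hi]
  rw [e1, e2, e3] at h1
  set e := ∑ x ∈ U, ∑ y ∈ U, ∑ z ∈ U, ind E x y z with he
  have h2 : e ^ 2 ≤ (#U : ℝ) ^ 2 * nrm E U := by
    have f1 : e ^ 2 ≤ #U * ∑ x ∈ U, (∑ y ∈ U, cod E U x y) ^ 2 := sq_sum_le_card_mul_sum_sq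
    have f2 : ∑ x ∈ U, (∑ y ∈ U, cod E U x y) ^ 2 ≤ #U * nrm E U := by
      rw [nrm, mul_sum]
      exact sum_le_sum fun x _ => sq_sum_le_card_mul_sum_sq
    nlinarith [mul_le_mul_of_nonneg_left f2 (Nat.cast_nonneg (α := ℝ) #U)]
  have h3 := nrm_nonneg E U
  rcases h3.eq_or_lt with h0 | h0
  · rw [← h0]; positivity
  · have h4 : 3 * nrm E U ≤ 2 * (#U * e) := by linarith
    have h5 : (3 * nrm E U) ^ 2 ≤ (2 * (#U * e)) ^ 2 := by gcongr
    have h6 : 9 * nrm E U * nrm E U ≤ 4 * (#U : ℝ) ^ 4 * nrm E U := by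
      have := mul_le_mul_of_nonneg_left h2 (sq_nonneg (#U : ℝ))
      linarith
    have := le_of_mul_le_mul_right h6 h0
    linarith

theorem delete_arith {n c w NU NW : ℝ} (hn : 12 ≤ n) (hc : 0 ≤ c) (hc1 : c ≤ 1 / 16) (hw0 : 0 ≤ w)
    (hw : w ≤ n) (h : (n - 4) * NU ≤ n * NW + (7.5 - 16 * c) * n ^ 4 + 30 * n ^ 3)
    (hNW : NW ≤ 5 / 8 * (n - 4) ^ 4 + 100 * (n - 4) ^ 3 - c * ((n - 4) ^ 4 - w ^ 4)) :
    NU ≤ 5 / 8 * n ^ 4 + 100 * n ^ 3 - c * (n ^ 4 - w ^ 4) := by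
  have h1 := mul_le_mul_of_nonneg_left hNW (by linarith : 0 ≤ n)
  have h2 : c * w ^ 4 ≤ c * n ^ 4 := by gcongr
  have h3 : 12 * n ^ 2 ≤ n ^ 3 := by nlinarith [sq_nonneg n]
  have h4 : 0 ≤ c * n := by positivity
  have h5 : c * n ≤ 1 / 16 * n := by gcongr
  have h6 : c * n ^ 2 ≤ 1 / 16 * n ^ 2 := by gcongr
  have h7 : 0 ≤ c * n ^ 3 := by positivity
  have h8 : 0 ≤ n ^ 2 := by positivity
  refine le_of_mul_le_mul_left (h.trans ?_) (by linarith : 0 < n - 4)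
  linarith

/-- The induction deleting copies of `K₄³`. -/
theorem exists_core {E : α → α → α → Bool} (hE : FanoFreeSys E) {c : ℝ} (hc : 0 ≤ c)
    (hc1 : c ≤ 1 / 16) {Good : Finset α → Prop} (h0 : Good ∅)
    (hG : ∀ U, Good U → nrm E U ≤ 5 / 8 * (#U : ℝ) ^ 4 + 100 * #U ^ 3)
    (hd : ∀ U : Finset α, ∀ a : Fin 4 → α, univ.image a ⊆ U → IsK4 E a → Good U ∨
      (#U - 4) * nrm E U ≤ #U * nrm E (U \ univ.image a) + (7.5 - 16 * c) * #U ^ 4 + 30 * #U ^ 3)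
    (U : Finset α) : ∃ W ⊆ U, Good W ∧
      nrm E U ≤ 5 / 8 * (#U : ℝ) ^ 4 + 100 * #U ^ 3 - c * ((#U : ℝ) ^ 4 - #W ^ 4) := by
  induction U using Finset.strongInduction with
  | H U ih =>
    have hn0 : (0 : ℝ) ≤ #U := by positivity
    have hc4 : c * (#U : ℝ) ^ 4 ≤ 1 / 16 * #U ^ 4 := by gcongr
    have hn3 : 0 ≤ (#U : ℝ) ^ 3 := by positivity
    by_cases h12 : 12 ≤ #U
    swap
    · have h12' : (#U : ℝ) ≤ 12 := by exact_mod_cast (by omega : #U ≤ 12)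
      refine ⟨∅, empty_subset _, h0, ?_⟩
      have := nrm_le_pow E U
      have : (#U : ℝ) * #U ^ 3 ≤ 12 * #U ^ 3 := by gcongr
      simp
      linarith
    by_cases hk : ∀ a : Fin 4 → α, univ.image a ⊆ U → ¬ IsK4 E a
    · refine ⟨∅, empty_subset _, h0, ?_⟩
      have := nrm_le_of_no_k4 hE hk
      have : 0 ≤ (#U : ℝ) ^ 4 := by positivity
      simp
      linarith
    push Not at hk
    obtain ⟨a, haU, ha⟩ := hk
    rcases hd U a haU ha with hgood | hd
    · exact ⟨U, Subset.rfl, hgood, by simpa using hG U hgood⟩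
    · have hcard : #(U \ univ.image a) + 4 = #U := by
        have := card_sdiff_add_card_eq_card haU
        rwa [card_image_of_injective _ (ha.injective hE), card_univ, Fintype.card_fin] at this
      have hcard' : (#(U \ univ.image a) : ℝ) = #U - 4 := by
        have : (#(U \ univ.image a) : ℝ) + 4 = #U := by exact_mod_cast hcard
        linarith
      obtain ⟨W, hW, hWg, hN⟩ := ih (U \ univ.image a)
        (sdiff_ssubset haU (by simp))
      have hWU := hW.trans sdiff_subset
      refine ⟨W, hWU, hWg, ?_⟩
      rw [hcard'] at hN
      exact delete_arith (by exact_mod_cast h12) hc hc1 (by positivity)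
        (by exact_mod_cast card_le_card hWU) hd hN

theorem nrm_le {E : α → α → α → Bool} (hE : FanoFreeSys E) (U : Finset α) :
    nrm E U ≤ 5 / 8 * (#U : ℝ) ^ 4 + 100 * #U ^ 3 := by
  obtain ⟨W, -, -, h⟩ := exists_core hE (c := 0) le_rfl (by norm_num) (Good := fun U => U = ∅) rfl
    (fun U hU => by simp [hU, nrm]) (fun U a haU ha => by
      right
      rcases delete_dichotomy hE ha haU 0 with h | h
      · linarith
      · linarith [h.1]) U
  linarith

/-- A 3-graph of large norm has a large almost bipartite part. -/
theorem exists_almostBip {E : α → α → α → Bool} (hE : FanoFreeSys E) {θ : ℝ} (hθ : 0 < θ)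
    (hθ1 : θ ≤ 0.05) (U : Finset α) : ∃ W ⊆ U, AlmostBip E (11 * θ) W ∧
      nrm E U ≤ 5 / 8 * (#U : ℝ) ^ 4 + 100 * #U ^ 3
        - θ ^ 2 / 16 * ((#U : ℝ) ^ 4 - #W ^ 4) := by
  refine exists_core hE (by positivity) (by nlinarith) ?_ (fun U _ => nrm_le hE U) ?_ U
  · exact ⟨∅, Subset.rfl, ∅, Subset.rfl, disjoint_empty_left _, by simp⟩
  · intro U a haU ha
    rcases delete_dichotomy hE ha haU (θ ^ 2) with h | ⟨-, hQ, R, hRU, hR, hρ, hW⟩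
    · right; linarith
    · left
      refine almostBip_of_close hE (linkMult_linkMult hE ha) ?_ hθ hθ1 hQ hRU hR hρ hW
      exact (univ_nonempty.image a).mono haU

end FanoL2

namespace FanoL2
open Finset

/-- The indicator of the triples spanning an edge. -/
def edgeInd {n : ℕ} (H : Finset (Finset (Fin n))) (x y z : Fin n) : Bool :=
  decide (({x, y, z} : Finset (Fin n)) ∈ H)

theorem fanoFreeSys_edgeInd {n : ℕ} {H : Finset (Finset (Fin n))} (h3 : Is3Graph H)
    (hF : FanoFree H) : FanoFreeSys (edgeInd H) where
  ne x y z h := by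
    rintro rfl
    have := h3 _ (of_decide_eq_true h)
    simp only [mem_singleton, insert_eq_of_mem, mem_insert, true_or] at this
    have := card_le_two (a := x) (b := z)
    omega
  swap x y z := by simp only [edgeInd, Finset.insert_comm]
  swap' x y z := by
    have : ({x, y, z} : Finset (Fin n)) = {x, z, y} := by rw [pair_comm]
    simp only [edgeInd, this]
  fano a b c u x y z h := by
    simp only [edgeInd, decide_eq_true_eq] at h
    obtain ⟨e1, e2, e3, e4, e5, e6, e7⟩ := h
    have hne : ∀ {p q r : Fin n}, ({p, q, r} : Finset (Fin n)) ∈ H → p ≠ q ∧ p ≠ r ∧ q ≠ r := by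
      intro p q r h
      have := h3 _ h
      refine ⟨?_, ?_, ?_⟩ <;> rintro rfl <;> simp at this
      · have := card_le_two (a := p) (b := r); omega
      · have := card_le_two (a := q) (b := p); simp at *; omega
      · have := card_le_two (a := p) (b := q); omega
    obtain ⟨a1, a2, a3⟩ := hne e1
    obtain ⟨b1, b2, b3⟩ := hne e2
    obtain ⟨c1, c2, c3⟩ := hne e3
    obtain ⟨d1, d2, d3⟩ := hne e4
    obtain ⟨f1, f2, f3⟩ := hne e5
    obtain ⟨g1, g2, g3⟩ := hne e6
    obtain ⟨k1, k2, k3⟩ := hne e7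
    refine hF ⟨![a, b, c, u, z, y, x], ?_, ?_⟩
    · intro i j hij
      fin_cases i <;> fin_cases j <;> first | rfl | (exfalso; simp at hij; first | exact absurd hij ‹_› | exact absurd hij.symm ‹_›)
    · intro e he
      simp only [fanoEdges, mem_insert, mem_singleton] at he
      rcases he with rfl | rfl | rfl | rfl | rfl | rfl | rfl <;>
        simp only [image_insert, image_singleton] <;>
        [convert e1 using 1; convert e6 using 1; convert e3 using 1; convert e2 using 1;
          convert e5 using 1; convert e7 using 1; convert e4 using 1] <;>
        (ext v; simp; try tauto)

theorem sum_sum_pair {n : ℕ} (f : Finset (Fin n) → ℝ) :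
    ∑ x, ∑ y, (if x = y then 0 else f {x, y}) = 2 * ∑ e ∈ powersetCard 2 univ, f e := by
  have h1 : ∑ x, ∑ y, (if x = y then 0 else f {x, y})
      = ∑ p ∈ (univ : Finset (Fin n)).offDiag, f {p.1, p.2} := by
    rw [← sum_product' univ univ fun x y : Fin n => if x = y then 0 else f {x, y},
      show (univ : Finset (Fin n)).offDiag =
        (univ ×ˢ univ).filter fun p : Fin n × Fin n => ¬p.1 = p.2 by ext; simp, sum_filter]
    refine sum_congr rfl fun p _ => ?_
    by_cases hp : p.1 = p.2 <;> simp [hp]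
  rw [h1, ← sum_fiberwise_of_maps_to (t := powersetCard 2 univ) (g := fun p => {p.1, p.2}),
    mul_sum]
  · refine sum_congr rfl fun e he => ?_
    obtain ⟨a, b, hab, rfl⟩ := card_eq_two.1 (mem_powersetCard.1 he).2
    have : {p ∈ (univ : Finset (Fin n)).offDiag | ({p.1, p.2} : Finset (Fin n)) = {a, b}}
        = {(a, b), (b, a)} := by
      ext ⟨x, y⟩
      simp only [mem_filter, mem_offDiag, mem_univ, true_and, mem_insert, mem_singleton,
        Prod.mk.injEq]
      constructor
      · rintro ⟨hxy, h⟩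
        have hx : x ∈ ({a, b} : Finset (Fin n)) := h ▸ by simp
        have hy : y ∈ ({a, b} : Finset (Fin n)) := h ▸ by simp
        simp only [mem_insert, mem_singleton] at hx hy
        grind
      · rintro (⟨rfl, rfl⟩ | ⟨rfl, rfl⟩)
        · exact ⟨hab, rfl⟩
        · exact ⟨hab.symm, pair_comm _ _⟩
    rw [this, sum_pair (by simp [hab]), pair_comm b a]
    ring
  · intro p hp
    simp only [mem_offDiag] at hp
    simp [mem_powersetCard, card_pair hp.2.2]

theorem nrm_edgeInd {n : ℕ} {H : Finset (Finset (Fin n))} (h3 : Is3Graph H) :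
    nrm (edgeInd H) univ = 2 * (l2norm H : ℝ) := by
  have h1 : (l2norm H : ℝ) = ∑ e ∈ powersetCard 2 univ, (codeg3 H e : ℝ) ^ 2 := by
    rw [l2norm, Nat.cast_sum]
    push_cast
    refine sum_subset ?_ fun e he h => ?_
    · intro e he
      simp only [shadow3, mem_filter, mem_univ, true_and] at he
      simp [mem_powersetCard, he.1]
    · simp only [shadow3, mem_filter, mem_univ, true_and, not_and, not_exists] at h
      have h' := h (mem_powersetCard.1 he).2
      have : codeg3 H e = 0 := by
        rw [codeg3, card_eq_zero, filter_eq_empty_iff]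
        rintro v - ⟨-, hv⟩
        exact h' _ hv (subset_insert _ _)
      simp [this]
  rw [h1, ← sum_sum_pair fun e => (codeg3 H e : ℝ) ^ 2, nrm]
  refine sum_congr rfl fun x _ => sum_congr rfl fun y _ => ?_
  split_ifs with hxy
  · subst hxy
    have : cod (edgeInd H) univ x x = 0 := by
      refine sum_eq_zero fun z _ => ?_
      have : ({x, z} : Finset (Fin n)) ∉ H := fun h => by
        have := h3 _ h
        have := card_le_two (a := x) (b := z)
        omega
      simp [ind, edgeInd, this]
    simp [this]
  · congr 1
    simp only [cod, ind, codeg3, card_filter, Nat.cast_sum]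
    refine sum_congr rfl fun z _ => ?_
    have e1 : insert z ({x, y} : Finset (Fin n)) = {x, y, z} := by
      rw [Finset.insert_comm, pair_comm z y]
    have e2 : z ∈ ({x, y} : Finset (Fin n)) → ({x, y, z} : Finset (Fin n)) ∉ H := fun hz h => by
      rw [← e1, insert_eq_of_mem hz] at h
      have := h3 _ h
      rw [card_pair hxy] at this
      omega
    rw [e1]
    by_cases hz : z ∈ ({x, y} : Finset (Fin n)) <;> by_cases hm : ({x, y, z} : Finset (Fin n)) ∈ H
    · exact absurd hm (e2 hz)
    all_goals simp [edgeInd, hm]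
    simpa using hz

/-- The complete bipartite 3-graph. -/
def completeBip {n : ℕ} (A : Finset (Fin n)) : Finset (Finset (Fin n)) :=
  {e | #e = 3 ∧ (e ∩ A).Nonempty ∧ (e \ A).Nonempty}

theorem is3Graph_completeBip {n : ℕ} (A : Finset (Fin n)) : Is3Graph (completeBip A) :=
  fun e he => by
    simp only [completeBip, mem_filter] at he
    exact he.2.1

set_option maxRecDepth 100000 in
theorem fano_not_two_colorable :
    ∀ c : Fin 7 → Bool, ∃ e ∈ fanoEdges, ∀ i ∈ e, ∀ j ∈ e, c i = c j := by
  decide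

theorem fanoFree_completeBip {n : ℕ} (A : Finset (Fin n)) : FanoFree (completeBip A) := by
  rintro ⟨f, -, hf⟩
  obtain ⟨e, he, hc⟩ := fano_not_two_colorable fun i => decide (f i ∈ A)
  have := hf e he
  simp only [completeBip, mem_filter] at this
  obtain ⟨-, -, ⟨v, hv⟩, w, hw⟩ := this
  simp only [mem_inter, mem_sdiff, mem_image] at hv hw
  obtain ⟨⟨i, hi, rfl⟩, hiA⟩ := hv
  obtain ⟨⟨j, hj, rfl⟩, hjA⟩ := hw
  have := hc i hi j hj
  simp_all

end FanoL2

namespace FanoL2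
open Finset

theorem edgeInd_completeBip {n : ℕ} {A : Finset (Fin n)} {x y z : Fin n} (hxy : x ≠ y)
    (hxz : x ≠ z) (hyz : y ≠ z) :
    edgeInd (completeBip A) x y z ↔ (x ∈ A ∨ y ∈ A ∨ z ∈ A) ∧ (x ∉ A ∨ y ∉ A ∨ z ∉ A) := by
  have h3 : #({x, y, z} : Finset (Fin n)) = 3 := card_eq_three.2 ⟨x, y, z, hxy, hxz, hyz, rfl⟩
  simp only [edgeInd, completeBip, mem_filter, mem_univ, h3, true_and, decide_eq_true_eq,
    Finset.Nonempty, mem_inter, mem_sdiff, mem_insert, mem_singleton]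
  grind

/-- The norm of a complete bipartite 3-graph. -/
theorem le_nrm_completeBip {n : ℕ} (A : Finset (Fin n)) (hn : 2 ≤ n) :
    2 * #A * #Aᶜ * ((n : ℝ) - 2) ^ 2 + ((#A : ℝ) ^ 2 - #A) * #Aᶜ ^ 2
      + ((#Aᶜ : ℝ) ^ 2 - #Aᶜ) * #A ^ 2 ≤ nrm (edgeInd (completeBip A)) univ := by
  set E := edgeInd (completeBip A) with hEdef
  have hn' : (2 : ℝ) ≤ n := by exact_mod_cast hn
  have cross : ∀ x y, x ≠ y → (x ∈ A ↔ y ∉ A) → (n : ℝ) - 2 ≤ cod E univ x y := by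
    intro x y hxy h
    have h1 : (#({x, y}ᶜ : Finset (Fin n)) : ℝ) = n - 2 := by
      rw [card_compl, card_pair hxy, Fintype.card_fin, Nat.cast_sub hn]; simp
    rw [← h1, card_eq_sum_ones, Nat.cast_sum, cod]
    refine (sum_le_sum fun z hz => ?_).trans
      (sum_le_sum_of_subset_of_nonneg (subset_univ _) fun _ _ _ => ind_nonneg ..)
    simp only [mem_compl, mem_insert, mem_singleton, not_or] at hz
    have : E x y z := (edgeInd_completeBip hxy (Ne.symm hz.1) (Ne.symm hz.2)).2 (by tauto)
    simp [ind, this]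
  have same : ∀ B : Finset (Fin n), (∀ x ∈ B, ∀ y ∈ B, ∀ z ∈ Bᶜ, x ≠ y → E x y z) →
      ((#B : ℝ) ^ 2 - #B) * #Bᶜ ^ 2 ≤ ∑ x ∈ B, ∑ y ∈ B, cod E univ x y ^ 2 := by
    intro B hB
    have h1 : ((#B : ℝ) ^ 2 - #B) * #Bᶜ ^ 2
        = ∑ x ∈ B, ∑ y ∈ B, ((#Bᶜ : ℝ) ^ 2 - if x = y then (#Bᶜ : ℝ) ^ 2 else 0) := by
      simp [sum_sub_distrib]
      ring
    rw [h1]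
    refine sum_le_sum fun x hx => sum_le_sum fun y hy => ?_
    split_ifs with hxy
    · simp [sq_nonneg]
    · rw [sub_zero]
      gcongr
      rw [card_eq_sum_ones, Nat.cast_sum, cod]
      refine (sum_le_sum fun z hz => ?_).trans
        (sum_le_sum_of_subset_of_nonneg (subset_univ _) fun _ _ _ => ind_nonneg ..)
      simp [ind, hB x hx y hy z hz hxy]
  have opp : ∀ B : Finset (Fin n), (∀ x ∈ B, ∀ y ∈ Bᶜ, (x ∈ A ↔ y ∉ A)) →
      (#B : ℝ) * #Bᶜ * (n - 2) ^ 2 ≤ ∑ x ∈ B, ∑ y ∈ Bᶜ, cod E univ x y ^ 2 := by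
    intro B hB
    have h1 : (#B : ℝ) * #Bᶜ * (n - 2) ^ 2 = ∑ x ∈ B, ∑ y ∈ Bᶜ, ((n : ℝ) - 2) ^ 2 := by
      simp only [sum_const, nsmul_eq_mul, mul_assoc]
    rw [h1]
    refine sum_le_sum fun x hx => sum_le_sum fun y hy => ?_
    have hxy : x ≠ y := by rintro rfl; exact mem_compl.1 hy hx
    have := cross x y hxy (hB x hx y hy)
    have : (0 : ℝ) ≤ n - 2 := by linarith
    gcongr
  have s1 := same A fun x hx y hy z hz hxy => by
    have hz' := mem_compl.1 hz
    exact (edgeInd_completeBip hxy (by grind) (by grind)).2 (by tauto)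
  have s2 := same Aᶜ fun x hx y hy z hz hxy => by
    simp only [compl_compl, mem_compl] at *
    exact (edgeInd_completeBip hxy (by grind) (by grind)).2 (by tauto)
  have o1 := opp A fun x hx y hy => by simp at *; tauto
  have o2 := opp Aᶜ fun x hx y hy => by simp at *; tauto
  rw [compl_compl] at s2 o2
  rw [nrm, ← sum_add_sum_compl A]
  simp only [← sum_add_sum_compl A (fun y => cod E univ _ y ^ 2), sum_add_distrib]
  linarith

theorem l2norm_le {n : ℕ} {H : Finset (Finset (Fin n))} (h3 : Is3Graph H) : l2norm H ≤ n ^ 4 := by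
  have h1 := nrm_le_pow (edgeInd H) univ
  rw [nrm_edgeInd h3, card_univ, Fintype.card_fin] at h1
  have : (0 : ℝ) ≤ l2norm H := by positivity
  have : (l2norm H : ℝ) ≤ (n : ℝ) ^ 4 := by linarith
  exact_mod_cast this

theorem le_exL2 {n : ℕ} {H : Finset (Finset (Fin n))} (h3 : Is3Graph H) (hF : FanoFree H) :
    l2norm H ≤ exL2 n :=
  le_csSup ⟨n ^ 4, by rintro m ⟨H, h3, -, rfl⟩; exact l2norm_le h3⟩ ⟨H, h3, hF, rfl⟩

theorem le_two_mul_exL2 {n : ℕ} (hn : 2 ≤ n) :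
    5 / 8 * (n : ℝ) ^ 4 - 5 * n ^ 3 ≤ 2 * exL2 n := by
  obtain ⟨A, -, hA⟩ := exists_subset_card_eq (s := (univ : Finset (Fin n))) (n := n / 2)
    (by simp; omega)
  have h1 := le_nrm_completeBip A hn
  rw [nrm_edgeInd (is3Graph_completeBip A)] at h1
  have h2 : (l2norm (completeBip A) : ℝ) ≤ exL2 n := by
    exact_mod_cast le_exL2 (is3Graph_completeBip A) (fanoFree_completeBip A)
  have hAc : #A + #Aᶜ = n := by simp [card_add_card_compl]
  have hab : (#A : ℝ) + #Aᶜ = n := by exact_mod_cast hAc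
  have hd : ((#A : ℝ) - #Aᶜ) ^ 2 ≤ 1 := by
    have h3 : (#A : ℝ) ≤ #Aᶜ := by exact_mod_cast (by omega : #A ≤ #Aᶜ)
    have h4 : (#Aᶜ : ℝ) ≤ #A + 1 := by exact_mod_cast (by omega : #Aᶜ ≤ #A + 1)
    nlinarith
  have hn' : (2 : ℝ) ≤ n := by exact_mod_cast hn
  set a : ℝ := (#A : ℝ)
  set b : ℝ := (#Aᶜ : ℝ)
  set N : ℝ := (n : ℝ)
  have hp : (N ^ 2 - 1) / 4 ≤ a * b := by rw [← hab]; nlinarith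
  have hp' : a * b ≤ N ^ 2 / 4 := by rw [← hab]; nlinarith [sq_nonneg (a - b)]
  have hN : 0 ≤ (N ^ 2 - 1) / 4 := by nlinarith
  have hp2 : ((N ^ 2 - 1) / 4) ^ 2 ≤ (a * b) ^ 2 := by gcongr
  have hp3 : (N ^ 2 - 1) / 4 * (N - 2) ^ 2 ≤ a * b * (N - 2) ^ 2 := by gcongr
  have hp4 : a * b * N ≤ N ^ 2 / 4 * N := by gcongr
  have e : 2 * a * b * (N - 2) ^ 2 + (a ^ 2 - a) * b ^ 2 + (b ^ 2 - b) * a ^ 2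
      = 2 * (a * b * (N - 2) ^ 2) + 2 * (a * b) ^ 2 - a * b * N := by rw [← hab]; ring
  rw [e] at h1
  have : 0 ≤ N ^ 3 := by positivity
  have : 2 * N ^ 2 ≤ N ^ 3 := by nlinarith [sq_nonneg N]
  nlinarith

end FanoL2

namespace FanoL2
open Finset

/-- The ordered triples in `X` spanning an edge. -/
def innerTriples {n : ℕ} (H : Finset (Finset (Fin n))) (X : Finset (Fin n)) :
    Finset (Fin n × Fin n × Fin n) :=
  {t ∈ X ×ˢ X ×ˢ X | edgeInd H t.1 t.2.1 t.2.2}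

theorem card_innerTriples {n : ℕ} (H : Finset (Finset (Fin n))) (X : Finset (Fin n)) :
    (#(innerTriples H X) : ℝ) = ∑ x ∈ X, ∑ y ∈ X, cod (edgeInd H) X x y := by
  simp only [innerTriples, card_filter, Nat.cast_sum, sum_product, cod, ind]
  refine sum_congr rfl fun x _ => sum_congr rfl fun y _ => sum_congr rfl fun z _ => ?_
  split_ifs <;> simp

/-- The number of edges to be removed to make `X, Xᶜ` a bipartition. -/
theorem card_removed_le {n : ℕ} {H : Finset (Finset (Fin n))} (h3 : Is3Graph H)
    (X Y : Finset (Fin n)) :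
    (#(H \ {e ∈ H | (e ∩ X).Nonempty ∧ (e \ X).Nonempty}) : ℝ) ≤
      ∑ x ∈ X, ∑ y ∈ X, cod (edgeInd H) X x y + ∑ x ∈ Y, ∑ y ∈ Y, cod (edgeInd H) Y x y
        + #(X ∪ Y)ᶜ * (n : ℝ) ^ 2 := by
  have hsub : H \ {e ∈ H | (e ∩ X).Nonempty ∧ (e \ X).Nonempty} ⊆
      (innerTriples H X ∪ innerTriples H Y ∪ (X ∪ Y)ᶜ ×ˢ univ ×ˢ univ).image
        fun t => ({t.1, t.2.1, t.2.2} : Finset (Fin n)) := by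
    intro e he
    simp only [mem_sdiff, mem_filter, not_and] at he
    obtain ⟨heH, he⟩ := he
    have he := he heH
    obtain ⟨x, y, z, -, -, -, rfl⟩ := card_eq_three.1 (h3 e heH)
    rw [mem_image]
    by_cases hR : ∃ v ∈ ({x, y, z} : Finset (Fin n)), v ∉ X ∪ Y
    · obtain ⟨v, hv, hvR⟩ := hR
      simp only [mem_insert, mem_singleton] at hv
      rcases hv with rfl | rfl | rfl
      · exact ⟨(v, y, z), mem_union_right _ (by simpa using hvR), rfl⟩
      · exact ⟨(v, x, z), mem_union_right _ (by simpa using hvR), Finset.insert_comm _ _ _⟩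
      · exact ⟨(v, x, y), mem_union_right _ (by simpa using hvR), by ext; simp; tauto⟩
    · push Not at hR
      refine ⟨(x, y, z), ?_, rfl⟩
      by_cases hX : ∀ v ∈ ({x, y, z} : Finset (Fin n)), v ∈ X
      · simp only [mem_insert, mem_singleton, forall_eq_or_imp, forall_eq] at hX
        simp [innerTriples, edgeInd, heH, hX]
      · have hX' : ∀ v ∈ ({x, y, z} : Finset (Fin n)), v ∉ X := by
          intro v hv hvX
          refine he ⟨v, mem_inter.2 ⟨hv, hvX⟩⟩ ?_
          push Not at hX
          obtain ⟨w, hw, hwX⟩ := hX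
          exact ⟨w, mem_sdiff.2 ⟨hw, hwX⟩⟩
        have hY : ∀ v ∈ ({x, y, z} : Finset (Fin n)), v ∈ Y := fun v hv =>
          (mem_union.1 (hR v hv)).resolve_left (hX' v hv)
        simp only [mem_insert, mem_singleton, forall_eq_or_imp, forall_eq] at hY
        simp [innerTriples, edgeInd, heH, hY]
  have h1 := (card_le_card hsub).trans (card_image_le.trans
    ((card_union_le _ _).trans (Nat.add_le_add_right (card_union_le _ _) _)))
  rw [← card_innerTriples, ← card_innerTriples]
  simp only [card_product, card_univ, Fintype.card_fin] at h1
  rw [sq]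
  exact_mod_cast h1

end FanoL2

/-- (ℓ2-edge-stability of 𝔽.) For every ε > 0 there are δ > 0 and N₀
such that every 𝔽-free 3-graph on n ≥ N₀ vertices with `‖H‖₂ ≥ (1 − δ)·ex_{ℓ2}(n, 𝔽)`
becomes bipartite after removing at most ε·n³ edges. -/
theorem fano_l2_edge_stable (ε : ℝ) (hε : 0 < ε) :
    ∃ (δ : ℝ) (N₀ : ℕ), 0 < δ ∧
      ∀ n : ℕ, N₀ ≤ n → ∀ H : Finset (Finset (Fin n)), Is3Graph H → FanoFree H →
        (1 - δ) * (exL2 n : ℝ) ≤ (l2norm H : ℝ) →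
        ∃ H' ⊆ H, ((H \ H').card : ℝ) ≤ ε * (n : ℝ) ^ 3 ∧ Bipartite3 H' := by
  obtain ⟨θ, hθ, hθ1, hθε⟩ : ∃ θ : ℝ, 0 < θ ∧ θ ≤ 0.05 ∧ 23 * θ ≤ ε :=
    ⟨min 0.05 (ε / 23), by positivity, min_le_left _ _, by
      linarith [min_le_right (0.05 : ℝ) (ε / 23)]⟩
  refine ⟨θ ^ 3 / 32, max 2 ⌈3360 / θ ^ 3⌉₊, by positivity, fun n hn H h3 hF hH => ?_⟩
  have hn2 : 2 ≤ n := (le_max_left _ _).trans hn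
  have hn0 : (0 : ℝ) < n := by exact_mod_cast (by omega : 0 < n)
  have hnθ : 3360 ≤ θ ^ 3 * n := by
    have : 3360 / θ ^ 3 ≤ n := Nat.ceil_le.1 ((le_max_right _ _).trans hn)
    rwa [div_le_iff₀' (by positivity)] at this
  obtain ⟨W, -, ⟨X, hXW, Y, hYW, hXY, hAB⟩, hN⟩ :=
    FanoL2.exists_almostBip (FanoL2.fanoFreeSys_edgeInd h3 hF) hθ hθ1 Finset.univ
  rw [FanoL2.nrm_edgeInd h3, Finset.card_univ, Fintype.card_fin] at hN
  have hex := FanoL2.le_two_mul_exL2 hn2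
  have hwn : (W.card : ℝ) ≤ n := by exact_mod_cast (Finset.card_le_univ W).trans_eq (by simp)
  have hc : ((X ∪ Y)ᶜ.card : ℝ) = ((W \ (X ∪ Y)).card : ℝ) + (n - W.card) := by
    have h1 := Finset.card_sdiff_add_card_eq_card (Finset.union_subset hXW hYW)
    have h2 := Finset.card_add_card_compl (X ∪ Y)
    rw [Fintype.card_fin] at h2
    have h1' : ((W \ (X ∪ Y)).card : ℝ) + (X ∪ Y).card = W.card := by exact_mod_cast h1
    have h2' : ((X ∪ Y).card : ℝ) + ((X ∪ Y)ᶜ.card : ℝ) = n := by exact_mod_cast h2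
    linarith
  have hrem := FanoL2.card_removed_le h3 X Y
  rw [hc] at hrem
  refine ⟨_, Finset.filter_subset _ _, hrem.trans ?_, X, fun e he => (Finset.mem_filter.1 he).2⟩
  have hS : ∀ Z : Finset (Fin n), 0 ≤ ∑ x ∈ Z, ∑ y ∈ Z, FanoL2.cod (FanoL2.edgeInd H) Z x y :=
    fun Z => Finset.sum_nonneg fun x _ => Finset.sum_nonneg fun y _ => FanoL2.cod_nonneg ..
  have hSX := hS X
  have hSY := hS Y
  set SX := ∑ x ∈ X, ∑ y ∈ X, FanoL2.cod (FanoL2.edgeInd H) X x y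
  set SY := ∑ x ∈ Y, ∑ y ∈ Y, FanoL2.cod (FanoL2.edgeInd H) Y x y
  have hr0 : 0 ≤ ((W \ (X ∪ Y)).card : ℝ) := Nat.cast_nonneg _
  have hw0 : 0 ≤ (W.card : ℝ) := Nat.cast_nonneg _
  set r : ℝ := ((W \ (X ∪ Y)).card : ℝ)
  set w : ℝ := (W.card : ℝ)
  set N : ℝ := (n : ℝ)
  have hW : N - w ≤ θ * N := by
    have hθ3 : θ ^ 3 ≤ 1 := pow_le_one₀ hθ.le (by linarith)
    have h1 := mul_le_mul_of_nonneg_left hex (by linarith : 0 ≤ 1 - θ ^ 3 / 32)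
    have h2 : θ ^ 2 / 16 * (N ^ 4 - w ^ 4) ≤ 105 * N ^ 3 + θ ^ 3 / 32 * N ^ 4 := by
      have : 0 ≤ θ ^ 3 * N ^ 4 := by positivity
      have : 0 ≤ θ ^ 3 * N ^ 3 := by positivity
      linarith
    have h3 : 3360 * N ^ 3 ≤ θ ^ 3 * N * N ^ 3 := by gcongr
    have h4 : w ^ 4 ≤ w * N ^ 3 := by
      have : w * w ^ 3 ≤ w * N ^ 3 := by gcongr
      linarith
    have h5 : θ ^ 2 / 16 * w ^ 4 ≤ θ ^ 2 / 16 * (w * N ^ 3) := by gcongr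
    have h6 : (θ ^ 2 / 16 * N ^ 3) * (N - w) ≤ (θ ^ 2 / 16 * N ^ 3) * (θ * N) := by linarith
    exact le_of_mul_le_mul_left h6 (by positivity)
  have hwpos : 0 < w := by nlinarith
  have hr : r ≤ 11 * θ * N := by
    have h1 : w ^ 2 * r ≤ w ^ 2 * (11 * θ * w) := by linarith
    have h2 := le_of_mul_le_mul_left h1 (by positivity)
    have h3 : 11 * θ * w ≤ 11 * θ * N := by gcongr
    linarith
  have hw3 : 11 * θ * w ^ 3 ≤ 11 * θ * N ^ 3 := by gcongr
  have hrw : 0 ≤ r * w ^ 2 := by positivity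
  have h1 : (r + (N - w)) * N ^ 2 ≤ (11 * θ * N + θ * N) * N ^ 2 := by gcongr
  have h2 : 23 * θ * N ^ 3 ≤ ε * N ^ 3 := by gcongr
  linarith
end

section
/- There exist δ > 0 and an integer N₀ such that the following holds for every 𝔽-free 3-graph H on n ≥ N₀ vertices with δ_{ℓ2}(H) ≥ (5/4 − δ)·n³: if there exists a vertex v ∈ V(H) such that H − v is bipartite, then H itself is bipartite. (This expresses that 𝔽 is ℓ2-vertex-extendable with respect to the family of bipartite 3-graphs.) -/
/-- `{x, y, z}` is an edge of `H`. -/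
def Tri {n : ℕ} (H : Finset (Finset (Fin n))) (x y z : Fin n) : Prop :=
  ({x, y, z} : Finset (Fin n)) ∈ H

instance {n : ℕ} (H : Finset (Finset (Fin n))) (x y z : Fin n) : Decidable (Tri H x y z) :=
  inferInstanceAs (Decidable (_ ∈ H))

/-- The codegree of an ordered pair of vertices. -/
def pairDeg {n : ℕ} (H : Finset (Finset (Fin n))) (x y : Fin n) : ℕ :=
  (Finset.univ.filter fun z => Tri H x y z).card

/-- The number of ordered pairs of vertices of `B` in the link of `u`. -/
def linkCount {n : ℕ} (H : Finset (Finset (Fin n))) (u : Fin n) (B : Finset (Fin n)) : ℕ :=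
  ((B ×ˢ B).filter fun p => Tri H u p.1 p.2).card

section Basic

variable {n : ℕ} {H : Finset (Finset (Fin n))}

lemma Tri.swap {x y z : Fin n} (h : Tri H x y z) : Tri H y x z := by
  unfold Tri at *
  rwa [Finset.insert_comm]

lemma Tri.rotate {x y z : Fin n} (h : Tri H x y z) : Tri H y z x := by
  unfold Tri at *
  convert h using 1
  ext t
  simp only [Finset.mem_insert, Finset.mem_singleton]
  tauto

lemma Tri.swap_right {x y z : Fin n} (h : Tri H x y z) : Tri H x z y :=
  h.rotate.rotate.swap

lemma Tri.ne (hH : Is3Graph H) {x y z : Fin n} (h : Tri H x y z) : x ≠ y := by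
  rintro rfl
  have h3 := hH _ h
  have h2 : ({x, x, z} : Finset (Fin n)).card ≤ 2 := by
    rw [Finset.insert_eq_of_mem (by simp)]
    exact Finset.card_le_two
  omega

lemma Tri.ne_right (hH : Is3Graph H) {x y z : Fin n} (h : Tri H x y z) : y ≠ z :=
  h.rotate.ne hH

lemma Tri.ne_left (hH : Is3Graph H) {x y z : Fin n} (h : Tri H x y z) : x ≠ z :=
  h.swap_right.ne hH

lemma pairDeg_self (hH : Is3Graph H) (x : Fin n) : pairDeg H x x = 0 := by
  unfold pairDeg
  rw [Finset.card_eq_zero, Finset.filter_eq_empty_iff]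
  exact fun z _ h => h.ne hH rfl

lemma pairDeg_comm (x y : Fin n) : pairDeg H x y = pairDeg H y x := by
  unfold pairDeg
  congr 1
  ext z
  simp only [Finset.mem_filter, Finset.mem_univ, true_and]
  exact ⟨Tri.swap, Tri.swap⟩

lemma pairDeg_le (x y : Fin n) : pairDeg H x y ≤ n := by
  unfold pairDeg
  exact (Finset.card_le_univ _).trans (by simp)

lemma codeg3_pair (hH : Is3Graph H) {x y : Fin n} :
    codeg3 H {x, y} = pairDeg H x y := by
  unfold codeg3 pairDeg
  congr 1
  ext z
  simp only [Finset.mem_filter, Finset.mem_univ, true_and]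
  constructor
  · rintro ⟨-, h⟩
    exact Tri.rotate h
  · intro h
    refine ⟨?_, h.rotate.rotate⟩
    simp only [Finset.mem_insert, Finset.mem_singleton, not_or]
    exact ⟨(h.ne_left hH).symm, (h.ne_right hH).symm⟩

/-- Summing over ordered pairs counts every two-element set twice. -/
lemma sum_offDiag_pair (f : Finset (Fin n) → ℕ) :
    ∑ p ∈ (Finset.univ : Finset (Fin n)).offDiag, f {p.1, p.2} =
      2 * ∑ e ∈ Finset.univ.filter (fun e : Finset (Fin n) => e.card = 2), f e := by
  rw [← Finset.sum_fiberwise_of_maps_to (s := (Finset.univ : Finset (Fin n)).offDiag)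
    (t := Finset.univ.filter (fun e : Finset (Fin n) => e.card = 2))
    (g := fun p => ({p.1, p.2} : Finset (Fin n))), Finset.mul_sum]
  · refine Finset.sum_congr rfl fun e he => ?_
    rw [Finset.mem_filter] at he
    obtain ⟨a, b, hab, rfl⟩ := Finset.card_eq_two.1 he.2
    have hfib : ((Finset.univ : Finset (Fin n)).offDiag.filter
        fun p => ({p.1, p.2} : Finset (Fin n)) = {a, b}) = {(a, b), (b, a)} := by
      ext ⟨x, y⟩
      simp only [Finset.mem_filter, Finset.mem_offDiag, Finset.mem_univ, true_and,
        Finset.mem_insert, Finset.mem_singleton, Prod.mk.injEq]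
      constructor
      · rintro ⟨hxy, h⟩
        have hx : x ∈ ({a, b} : Finset (Fin n)) := by rw [← h]; simp
        have hy : y ∈ ({a, b} : Finset (Fin n)) := by rw [← h]; simp
        simp only [Finset.mem_insert, Finset.mem_singleton] at hx hy
        grind
      · rintro (⟨rfl, rfl⟩ | ⟨rfl, rfl⟩)
        · exact ⟨hab, rfl⟩
        · exact ⟨hab.symm, Finset.pair_comm _ _⟩
    rw [hfib, Finset.sum_pair (by simp [hab]), Finset.pair_comm b a]
    ring
  · rintro ⟨x, y⟩ h
    simp only [Finset.mem_offDiag, Finset.mem_univ, true_and] at h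
    simp [Finset.card_pair h]

lemma two_mul_l2norm (hH : Is3Graph H) :
    2 * l2norm H = ∑ x, ∑ y, pairDeg H x y ^ 2 := by
  have h1 : l2norm H =
      ∑ e ∈ Finset.univ.filter (fun e : Finset (Fin n) => e.card = 2), codeg3 H e ^ 2 := by
    unfold l2norm
    apply Finset.sum_subset
    · intro e he
      simp only [shadow3, Finset.mem_filter] at he ⊢
      exact ⟨he.1, he.2.1⟩
    · intro e he hne
      simp only [shadow3, Finset.mem_filter, Finset.mem_univ, true_and] at he hne
      have : codeg3 H e = 0 := by
        unfold codeg3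
        rw [Finset.card_eq_zero, Finset.filter_eq_empty_iff]
        rintro z - ⟨-, hz⟩
        exact hne ⟨he, _, hz, Finset.subset_insert _ _⟩
      simp [this]
  rw [h1, ← sum_offDiag_pair, ← Finset.sum_product', Finset.univ_product_univ]
  simp only [codeg3_pair hH]
  apply Finset.sum_subset (Finset.subset_univ _)
  rintro ⟨x, y⟩ - h
  simp only [Finset.mem_offDiag, Finset.mem_univ, true_and, not_not] at h
  subst h
  simp [pairDeg_self hH]

lemma tri_delVert {v x y z : Fin n} :
    Tri (delVert H v) x y z ↔ Tri H x y z ∧ v ≠ x ∧ v ≠ y ∧ v ≠ z := by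
  simp [Tri, delVert]

lemma pairDeg_sq_le (v x y : Fin n) :
    pairDeg H x y ^ 2 ≤ pairDeg (delVert H v) x y ^ 2 +
      ((if x = v then pairDeg H v y ^ 2 else 0) + (if y = v then pairDeg H v x ^ 2 else 0) +
        2 * (if Tri H v x y then pairDeg H x y else 0)) := by
  by_cases hx : x = v
  · subst hx
    rw [if_pos rfl]
    omega
  by_cases hy : y = v
  · subst hy
    rw [pairDeg_comm x y]
    rw [if_pos (rfl : y = y)]
    omega
  have hle : pairDeg H x y ≤ pairDeg (delVert H v) x y + if Tri H v x y then 1 else 0 := by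
    unfold pairDeg
    have hsub : (Finset.univ.filter fun z => Tri H x y z) ⊆
        (Finset.univ.filter fun z => Tri (delVert H v) x y z) ∪
          (if Tri H v x y then {v} else ∅) := by
      intro z hz
      simp only [Finset.mem_filter, Finset.mem_univ, true_and, Finset.mem_union,
        tri_delVert] at hz ⊢
      by_cases hzv : z = v
      · subst hzv
        rw [if_pos hz.rotate.rotate]
        simp
      · exact Or.inl ⟨hz, Ne.symm hx, Ne.symm hy, Ne.symm hzv⟩
    refine (Finset.card_le_card hsub).trans ((Finset.card_union_le _ _).trans ?_)
    split_ifs <;> simp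
  split_ifs at hle ⊢
  · rcases Nat.eq_zero_or_pos (pairDeg H x y) with h0 | h0
    · simp [h0]
    · obtain ⟨k, hk⟩ := Nat.exists_eq_succ_of_ne_zero h0.ne'
      rw [hk] at hle ⊢
      have : k ^ 2 ≤ pairDeg (delVert H v) x y ^ 2 := Nat.pow_le_pow_left (by omega) _
      rw [Nat.succ_eq_add_one]
      linarith
  · simpa using Nat.pow_le_pow_left hle 2

lemma d2deg_le (hH : Is3Graph H) (v : Fin n) :
    d2deg H v ≤ ((∑ u, pairDeg H v u ^ 2 +
      ∑ x, ∑ y, if Tri H v x y then pairDeg H x y else 0 : ℕ) : ℝ) := by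
  have hH' : Is3Graph (delVert H v) := fun e he => hH e (Finset.mem_filter.1 he).1
  have h1 := two_mul_l2norm hH
  have h2 := two_mul_l2norm hH'
  have h3 : ∑ x, ∑ y, pairDeg H x y ^ 2 ≤ _ :=
    Finset.sum_le_sum fun x _ => Finset.sum_le_sum fun y _ => pairDeg_sq_le (H := H) v x y
  simp only [Finset.sum_add_distrib, ← Finset.mul_sum] at h3
  rw [Finset.sum_comm (f := fun x y => if x = v then pairDeg H v y ^ 2 else 0)] at h3
  simp only [Finset.sum_ite_eq', Finset.mem_univ, if_true] at h3
  rw [← h1, ← h2] at h3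
  have h4 : l2norm H ≤ l2norm (delVert H v) + (∑ u, pairDeg H v u ^ 2 +
      ∑ x, ∑ y, if Tri H v x y then pairDeg H x y else 0) := by omega
  unfold d2deg
  rw [sub_le_iff_le_add']
  exact_mod_cast h4

end Basic

/-- If `G`, `J`, `K` are relations on a finite set such that `G` is not too sparse and `J`, `K` are
almost complete, then some four points are joined by `G`, `J`, `K` along the three perfect
matchings. -/
lemma exists_matchings {α : Type*} [DecidableEq α] (B : Finset α) (G J K : α → α → Prop)
    [∀ x y, Decidable (G x y)] [∀ x y, Decidable (J x y)] [∀ x y, Decidable (K x y)]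
    (h : 2 * (((B ×ˢ B).filter fun p => ¬ J p.1 p.2).card +
      ((B ×ˢ B).filter fun p => ¬ K p.1 p.2).card) * B.card ^ 2 <
      ((B ×ˢ B).filter fun p => G p.1 p.2).card ^ 2) :
    ∃ w ∈ B, ∃ z ∈ B, ∃ w' ∈ B, ∃ z' ∈ B,
      G w z ∧ G w' z' ∧ J w w' ∧ J z z' ∧ K w z' ∧ K z w' := by
  by_contra! hcon
  set g := (B ×ˢ B).filter fun p => G p.1 p.2 with hg
  set mJ := (B ×ˢ B).filter fun p => ¬ J p.1 p.2 with hmJ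
  set mK := (B ×ˢ B).filter fun p => ¬ K p.1 p.2 with hmK
  have hsub : g ×ˢ g ⊆
      (((mJ ×ˢ (B ×ˢ B)).image fun q => ((q.1.1, q.2.1), (q.1.2, q.2.2))) ∪
      ((mJ ×ˢ (B ×ˢ B)).image fun q => ((q.2.1, q.1.1), (q.2.2, q.1.2)))) ∪
      (((mK ×ˢ (B ×ˢ B)).image fun q => ((q.1.1, q.2.1), (q.2.2, q.1.2))) ∪
      ((mK ×ˢ (B ×ˢ B)).image fun q => ((q.2.1, q.1.1), (q.1.2, q.2.2)))) := by
    rintro ⟨⟨w, z⟩, ⟨w', z'⟩⟩ hp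
    simp only [hg, Finset.mem_product, Finset.mem_filter] at hp
    obtain ⟨⟨⟨hw, hz⟩, h1⟩, ⟨hw', hz'⟩, h2⟩ := hp
    have h3 := hcon w hw z hz w' hw' z' hz' h1 h2
    simp only [Finset.mem_union, Finset.mem_image, Finset.mem_product, Finset.mem_filter, hmJ, hmK,
      Prod.exists, Prod.mk.injEq]
    by_cases j1 : J w w'
    · by_cases j2 : J z z'
      · by_cases k1 : K w z'
        · exact Or.inr (Or.inr ⟨z, w', w, z', ⟨⟨⟨hz, hw'⟩, h3 j1 j2 k1⟩, hw, hz'⟩, by simp⟩)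
        · exact Or.inr (Or.inl ⟨w, z', z, w', ⟨⟨⟨hw, hz'⟩, k1⟩, hz, hw'⟩, by simp⟩)
      · exact Or.inl (Or.inr ⟨z, z', w, w', ⟨⟨⟨hz, hz'⟩, j2⟩, hw, hw'⟩, by simp⟩)
    · exact Or.inl (Or.inl ⟨w, w', z, z', ⟨⟨⟨hw, hw'⟩, j1⟩, hz, hz'⟩, by simp⟩)
  have hcard := (Finset.card_le_card hsub).trans ((Finset.card_union_le _ _).trans
    (Nat.add_le_add ((Finset.card_union_le _ _).trans
      (Nat.add_le_add Finset.card_image_le Finset.card_image_le))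
      ((Finset.card_union_le _ _).trans
      (Nat.add_le_add Finset.card_image_le Finset.card_image_le))))
  simp only [Finset.card_product] at hcard
  nlinarith

/-- The vertex `v` is outside the disjoint sets `A` and `B`, which cover all other vertices, and no
edge of `H` lies inside `A` or inside `B`. -/
structure Splits {n : ℕ} (H : Finset (Finset (Fin n))) (v : Fin n) (A B : Finset (Fin n)) :
    Prop where
  disj : Disjoint A B
  notMem_left : v ∉ A
  notMem_right : v ∉ B
  cover : ∀ x, x ≠ v → x ∈ A ∨ x ∈ B
  not_tri_left : ∀ x ∈ A, ∀ y ∈ A, ∀ z ∈ A, ¬ Tri H x y z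
  not_tri_right : ∀ x ∈ B, ∀ y ∈ B, ∀ z ∈ B, ¬ Tri H x y z

namespace Splits

variable {n : ℕ} {H : Finset (Finset (Fin n))} {v : Fin n} {A B : Finset (Fin n)}

lemma symm (h : Splits H v A B) : Splits H v B A where
  disj := h.disj.symm
  notMem_left := h.notMem_right
  notMem_right := h.notMem_left
  cover x hx := (h.cover x hx).symm
  not_tri_left := h.not_tri_right
  not_tri_right := h.not_tri_left

lemma univ_eq (h : Splits H v A B) : (Finset.univ : Finset (Fin n)) = insert v (A ∪ B) := by
  ext x
  have := h.cover x
  simp only [Finset.mem_univ, Finset.mem_insert, Finset.mem_union, true_iff]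
  tauto

lemma sum_univ (h : Splits H v A B) (f : Fin n → ℕ) :
    ∑ x, f x = f v + (∑ x ∈ A, f x + ∑ x ∈ B, f x) := by
  rw [h.univ_eq, Finset.sum_insert (by simp [h.notMem_left, h.notMem_right]),
    Finset.sum_union h.disj]

lemma card (h : Splits H v A B) : 1 + (A.card + B.card) = n := by
  simpa using (h.sum_univ fun _ => 1).symm

lemma pairDeg_le (h : Splits H v A B) {x y : Fin n} (hx : x ∈ A) (hy : y ∈ A) :
    pairDeg H x y ≤ B.card + 1 := by
  rw [← Finset.card_insert_of_notMem h.notMem_right]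
  refine Finset.card_le_card fun z hz => ?_
  simp only [Finset.mem_filter, Finset.mem_univ, true_and] at hz
  rw [Finset.mem_insert]
  by_contra! hcon
  exact h.not_tri_left x hx y hy z ((h.cover z hcon.1).resolve_right hcon.2) hz

lemma sum_link_eq (u : Fin n) (B : Finset (Fin n)) (c : ℕ) :
    ∑ x ∈ B, ∑ y ∈ B, (if Tri H u x y then c else 0) = linkCount H u B * c := by
  rw [← Finset.sum_product' B B fun x y => if Tri H u x y then c else 0, ← Finset.sum_filter,
    Finset.sum_const, smul_eq_mul]
  rfl

lemma sum_sum_const_le {s t : Finset (Fin n)} {f : Fin n → Fin n → ℕ} {c : ℕ}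
    (hf : ∀ x ∈ s, ∀ y ∈ t, f x y ≤ c) : ∑ x ∈ s, ∑ y ∈ t, f x y ≤ s.card * (t.card * c) := by
  rw [← smul_eq_mul (a := t.card), ← smul_eq_mul (a := s.card)]
  exact Finset.sum_le_card_nsmul _ _ _ fun x hx =>
    Finset.sum_le_card_nsmul _ _ _ fun y hy => hf x hx y hy

/-- The upper bound on the ℓ2-norm degree of a vertex of one of the parts. -/
lemma degree_le (h : Splits H v A B) {u : Fin n} (hu : u ∈ A) :
    ∑ w, pairDeg H u w ^ 2 + ∑ x, ∑ y, (if Tri H u x y then pairDeg H x y else 0) ≤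
      3 * n ^ 2 + A.card * (B.card + 1) ^ 2 + B.card * n ^ 2 + 2 * (A.card * B.card * n) +
        linkCount H u B * (A.card + 1) := by
  have hle : ∀ x y, (if Tri H u x y then pairDeg H x y else 0) ≤ n := fun x y => by
    split_ifs
    · exact _root_.pairDeg_le x y
    · exact Nat.zero_le _
  have s1 : ∑ w, pairDeg H u w ^ 2 ≤
      n ^ 2 + (A.card * (B.card + 1) ^ 2 + B.card * n ^ 2) := by
    rw [h.sum_univ]
    refine Nat.add_le_add (Nat.pow_le_pow_left (_root_.pairDeg_le _ _) _) (Nat.add_le_add ?_ ?_)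
    · exact Finset.sum_le_card_nsmul _ _ _ fun w hw =>
        Nat.pow_le_pow_left (h.pairDeg_le hu hw) _
    · exact Finset.sum_le_card_nsmul _ _ _ fun w _ =>
        Nat.pow_le_pow_left (_root_.pairDeg_le _ _) _
  have c := h.card
  have sv : ∑ y, (if Tri H u v y then pairDeg H v y else 0) ≤ n * n := by
    simpa using Finset.sum_le_card_nsmul Finset.univ _ _ fun y _ => hle v y
  have sAA : ∑ x ∈ A, ∑ y ∈ A, (if Tri H u x y then pairDeg H x y else 0) = 0 :=
    Finset.sum_eq_zero fun x hx => Finset.sum_eq_zero fun y hy =>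
      if_neg (h.not_tri_left u hu x hx y hy)
  have sBB : ∑ x ∈ B, ∑ y ∈ B, (if Tri H u x y then pairDeg H x y else 0) ≤
      linkCount H u B * (A.card + 1) := by
    rw [← sum_link_eq]
    refine Finset.sum_le_sum fun x hx => Finset.sum_le_sum fun y hy => ?_
    split_ifs
    · exact h.symm.pairDeg_le hx hy
    · exact le_rfl
  have sAB : ∑ x ∈ A, ∑ y ∈ B, (if Tri H u x y then pairDeg H x y else 0) ≤
      A.card * (B.card * n) := sum_sum_const_le fun x _ y _ => hle x y
  have sBA : ∑ x ∈ B, ∑ y ∈ A, (if Tri H u x y then pairDeg H x y else 0) ≤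
      B.card * (A.card * n) := sum_sum_const_le fun x _ y _ => hle x y
  have sAv : ∑ x ∈ A, (if Tri H u x v then pairDeg H x v else 0) ≤ A.card * n :=
    Finset.sum_le_card_nsmul _ _ _ fun x _ => hle x v
  have sBv : ∑ x ∈ B, (if Tri H u x v then pairDeg H x v else 0) ≤ B.card * n :=
    Finset.sum_le_card_nsmul _ _ _ fun x _ => hle x v
  have s2 : ∑ x, ∑ y, (if Tri H u x y then pairDeg H x y else 0) ≤
      n * n + ((A.card * n + (0 + A.card * (B.card * n))) + (B.card * n +
        (B.card * (A.card * n) + linkCount H u B * (A.card + 1)))) := by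
    rw [h.sum_univ]
    refine Nat.add_le_add sv (Nat.add_le_add ?_ ?_)
    · simp only [h.sum_univ fun y => if Tri H u _ y then pairDeg H _ y else 0,
        Finset.sum_add_distrib]
      exact Nat.add_le_add sAv (Nat.add_le_add sAA.le sAB)
    · simp only [h.sum_univ fun y => if Tri H u _ y then pairDeg H _ y else 0,
        Finset.sum_add_distrib]
      exact Nat.add_le_add sBv (Nat.add_le_add sBA sBB)
  have hn : A.card * n + B.card * n ≤ n * n := by
    rw [← Nat.add_mul]
    exact Nat.mul_le_mul_right _ (by omega)
  nlinarith

lemma sum_sq_le (h : Splits H v A B) (hH : Is3Graph H) :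
    ∑ u ∈ A, pairDeg H v u ^ 2 ≤ A.card * B.card ^ 2 + 2 * n * linkCount H v A := by
  have c := h.card
  have hdeg : linkCount H v A = ∑ u ∈ A, (A.filter fun z => Tri H v u z).card := by
    rw [← mul_one (linkCount H v A), ← sum_link_eq]
    simp only [Finset.card_filter]
  have hpt : ∀ u ∈ A, pairDeg H v u ^ 2 ≤
      B.card ^ 2 + 2 * n * (A.filter fun z => Tri H v u z).card := by
    intro u _
    have h1 : pairDeg H v u ≤ B.card + (A.filter fun z => Tri H v u z).card := by
      refine le_trans (Finset.card_le_card fun z hz => ?_) (Finset.card_union_le _ _)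
      simp only [Finset.mem_filter, Finset.mem_univ, true_and, Finset.mem_union] at hz ⊢
      rcases h.cover z (hz.ne_left hH).symm with hz' | hz'
      · exact Or.inr ⟨hz', hz⟩
      · exact Or.inl hz'
    have h2 : (A.filter fun z => Tri H v u z).card ≤ A.card := Finset.card_filter_le _ _
    calc pairDeg H v u ^ 2 ≤ (B.card + (A.filter fun z => Tri H v u z).card) ^ 2 :=
          Nat.pow_le_pow_left h1 _
      _ = B.card ^ 2 + (2 * B.card + (A.filter fun z => Tri H v u z).card) *
            (A.filter fun z => Tri H v u z).card := by ring
      _ ≤ _ := by gcongr; omega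
  refine (Finset.sum_le_sum hpt).trans_eq ?_
  rw [Finset.sum_add_distrib, ← Finset.mul_sum, ← hdeg, Finset.sum_const, smul_eq_mul]

/-- The upper bound on the ℓ2-norm degree of the exceptional vertex. -/
lemma degree_exceptional_le (h : Splits H v A B) (hH : Is3Graph H) :
    ∑ w, pairDeg H v w ^ 2 + ∑ x, ∑ y, (if Tri H v x y then pairDeg H x y else 0) ≤
      3 * (A.card * B.card * n) + 3 * n * (linkCount H v A + linkCount H v B) := by
  have c := h.card
  have s1 : ∑ w, pairDeg H v w ^ 2 ≤ 0 + ((A.card * B.card ^ 2 + 2 * n * linkCount H v A) +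
      (B.card * A.card ^ 2 + 2 * n * linkCount H v B)) := by
    rw [h.sum_univ]
    exact Nat.add_le_add (by simp [pairDeg_self hH])
      (Nat.add_le_add (h.sum_sq_le hH) (h.symm.sum_sq_le hH))
  have s2 : ∑ x, ∑ y, (if Tri H v x y then pairDeg H x y else 0) ≤
      ∑ x, ∑ y, (if Tri H v x y then n else 0) := by
    refine Finset.sum_le_sum fun x _ => Finset.sum_le_sum fun y _ => ?_
    split_ifs
    · exact _root_.pairDeg_le _ _
    · exact le_rfl
  have hv1 : ∀ y, ¬ Tri H v v y := fun y hy => hy.ne hH rfl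
  have hv2 : ∀ x, ¬ Tri H v x v := fun x hx => hx.ne_left hH rfl
  have sAB : ∑ x ∈ A, ∑ y ∈ B, (if Tri H v x y then n else 0) ≤ A.card * (B.card * n) :=
    sum_sum_const_le fun x _ y _ => by split_ifs <;> simp
  have sBA : ∑ x ∈ B, ∑ y ∈ A, (if Tri H v x y then n else 0) ≤ B.card * (A.card * n) :=
    sum_sum_const_le fun x _ y _ => by split_ifs <;> simp
  have s3 : ∑ x, ∑ y, (if Tri H v x y then n else 0) ≤
      (linkCount H v A * n + A.card * (B.card * n)) +
        (B.card * (A.card * n) + linkCount H v B * n) := by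
    rw [h.sum_univ]
    simp only [h.sum_univ fun y => if Tri H v _ y then n else 0, hv1, hv2, if_false,
      Finset.sum_add_distrib, Finset.sum_const_zero, zero_add, sum_link_eq]
    omega
  have hab : A.card * B.card ^ 2 + B.card * A.card ^ 2 ≤ A.card * B.card * n := by
    calc _ = A.card * B.card * (A.card + B.card) := by ring
      _ ≤ _ := Nat.mul_le_mul_left _ (by omega)
  nlinarith

lemma linkCount_le (u : Fin n) : linkCount H u B ≤ B.card ^ 2 := by
  unfold linkCount
  refine (Finset.card_filter_le _ _).trans ?_
  rw [Finset.card_product, sq]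

lemma card_not_link (u : Fin n) :
    ((B ×ˢ B).filter fun p => ¬ Tri H u p.1 p.2).card + linkCount H u B = B.card ^ 2 := by
  unfold linkCount
  rw [add_comm, Finset.card_filter_add_card_filter_not, Finset.card_product, sq]

/-- In a Fano-free 3-graph, an edge `{v, x, y}` with `x, y ∈ A` forces the link of `v` to be sparse
in `B` as soon as the links of `x` and `y` are almost complete in `B`. -/
lemma linkCount_sq_le (h : Splits H v A B) (hH : Is3Graph H) (hF : FanoFree H) {x y : Fin n}
    (hx : x ∈ A) (hy : y ∈ A) (hxy : Tri H v x y) :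
    (linkCount H v B : ℝ) ^ 2 ≤
      2 * ((B.card ^ 2 - linkCount H x B) + (B.card ^ 2 - linkCount H y B)) * B.card ^ 2 := by
  have hmiss : ∀ u, (B.card : ℝ) ^ 2 - linkCount H u B =
      ((B ×ˢ B).filter fun p => ¬ Tri H u p.1 p.2).card := fun u => by
    rw [sub_eq_iff_eq_add]
    exact_mod_cast (card_not_link u).symm
  by_contra! hcon
  rw [hmiss, hmiss] at hcon
  obtain ⟨w, hw, z, hz, w', hw', z', hz', g1, g2, j1, j2, k1, k2⟩ :=
    exists_matchings B (Tri H v) (Tri H x) (Tri H y) (by exact_mod_cast hcon)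
  have hAB : ∀ s ∈ A, ∀ t ∈ B, s ≠ t := fun s hs t ht e =>
    Finset.disjoint_left.1 h.disj hs (e ▸ ht)
  have hvB : ∀ t ∈ B, v ≠ t := fun t ht e => h.notMem_right (e ▸ ht)
  have e1 := hxy.ne hH
  have e2 := hxy.ne_left hH
  have e3 := hxy.ne_right hH
  have e4 := g1.ne_right hH
  have e5 := g2.ne_right hH
  have e6 := j1.ne_right hH
  have e7 := j2.ne_right hH
  have e8 := k1.ne_right hH
  have e9 := k2.ne_right hH
  refine hF ⟨![v, x, y, z', w, z, w'], ?_, ?_⟩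
  · have a1 := hAB x hx w hw
    have a2 := hAB x hx z hz
    have a3 := hAB x hx w' hw'
    have a4 := hAB x hx z' hz'
    have b1 := hAB y hy w hw
    have b2 := hAB y hy z hz
    have b3 := hAB y hy w' hw'
    have b4 := hAB y hy z' hz'
    have c1 := hvB w hw
    have c2 := hvB z hz
    have c3 := hvB w' hw'
    have c4 := hvB z' hz'
    intro i j hij
    fin_cases i <;> fin_cases j <;> simp at hij ⊢ <;> grind
  · intro e he
    simp only [fanoEdges, Finset.mem_insert, Finset.mem_singleton] at he
    rcases he with rfl | rfl | rfl | rfl | rfl | rfl | rfl <;>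
      simp only [Finset.image_insert, Finset.image_singleton]
    · exact hxy
    · exact k1.swap_right
    · exact g1.rotate
    · exact g2
    · exact j1.swap_right
    · exact k2.swap_right
    · exact j2.swap_right

end Splits

/-- If neither part can absorb `v`, both parts contain a pair from the link of `v`. -/
lemma exists_tri_of_not_bipartite {n : ℕ} {H : Finset (Finset (Fin n))} {v : Fin n}
    {A B : Finset (Fin n)} (h : Splits H v A B) (hH : Is3Graph H) (hb : ¬ Bipartite3 H) :
    ∃ x ∈ A, ∃ y ∈ A, Tri H v x y := by
  by_contra! hcon
  refine hb ⟨B, fun e he => ?_⟩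
  obtain ⟨x, y, z, -, -, -, rfl⟩ := Finset.card_eq_three.1 (hH e he)
  have ht : Tri H x y z := he
  have hdis : ∀ t, t ∈ A → t ∉ B := fun _ ht => Finset.disjoint_left.1 h.disj ht
  have key : ∀ t, t ∉ B → t = v ∨ t ∈ A := fun t h' => by
    have := h.cover t
    tauto
  constructor
  · by_contra hne
    rw [Finset.not_nonempty_iff_eq_empty, ← Finset.disjoint_iff_inter_eq_empty] at hne
    simp only [Finset.disjoint_insert_left, Finset.disjoint_singleton_left] at hne
    have e1 := ht.ne hH
    have e2 := ht.ne_left hH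
    have e3 := ht.ne_right hH
    rcases key x hne.1 with rfl | hx
    · rcases key y hne.2.1 with rfl | hy
      · exact e1 rfl
      rcases key z hne.2.2 with rfl | hz
      · exact e2 rfl
      exact hcon y hy z hz ht
    rcases key y hne.2.1 with rfl | hy
    · rcases key z hne.2.2 with rfl | hz
      · exact e3 rfl
      exact hcon x hx z hz ht.swap
    rcases key z hne.2.2 with rfl | hz
    · exact hcon x hx y hy ht.rotate.rotate
    exact h.not_tri_left x hx y hy z hz ht
  · by_contra hne
    rw [Finset.not_nonempty_iff_eq_empty, Finset.sdiff_eq_empty_iff_subset] at hne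
    simp only [Finset.insert_subset_iff, Finset.singleton_subset_iff] at hne
    exact h.not_tri_right x hne.1 y hne.2.1 z hne.2.2 ht

lemma exists_splits {n : ℕ} {H : Finset (Finset (Fin n))} {v : Fin n}
    (h : Bipartite3 (delVert H v)) : ∃ A B, Splits H v A B := by
  obtain ⟨S, hS⟩ := h
  refine ⟨S.erase v, Sᶜ.erase v, ?_, by simp, by simp, ?_, ?_, ?_⟩
  · rw [Finset.disjoint_left]
    intro x
    simp only [Finset.mem_erase, Finset.mem_compl]
    tauto
  · intro x hx
    simp only [Finset.mem_erase, Finset.mem_compl]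
    tauto
  · intro x hx y hy z hz ht
    rw [Finset.mem_erase] at hx hy hz
    obtain ⟨t, ht⟩ := (hS _ (tri_delVert.2 ⟨ht, hx.1.symm, hy.1.symm, hz.1.symm⟩)).2
    simp only [Finset.mem_sdiff, Finset.mem_insert, Finset.mem_singleton] at ht
    grind
  · intro x hx y hy z hz ht
    rw [Finset.mem_erase, Finset.mem_compl] at hx hy hz
    obtain ⟨t, ht⟩ := (hS _ (tri_delVert.2 ⟨ht, hx.1.symm, hy.1.symm, hz.1.symm⟩)).1
    simp only [Finset.mem_inter, Finset.mem_insert, Finset.mem_singleton] at ht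
    grind

/-- Normalised degree bound: lower order terms are absorbed. -/
lemma normalized_bound {n a b g : ℝ} (hn : 10 ^ 8 ≤ n) (ha : 0 ≤ a) (hb : 0 ≤ b)
    (hc : 1 + (a + b) = n) (hg : g ≤ b ^ 2)
    (h : (5 / 4 - 1 / 10 ^ 7) * n ^ 3 ≤
      3 * n ^ 2 + a * (b + 1) ^ 2 + b * n ^ 2 + 2 * (a * b * n) + g * (a + 1)) :
    5 / 4 - 2 / 10 ^ 7 ≤
      a / n * (b / n) ^ 2 + b / n + 2 * (a / n * (b / n)) + g / n ^ 2 * (a / n) := by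
  have hn0 : 0 < n := by linarith
  have e : a / n * (b / n) ^ 2 + b / n + 2 * (a / n * (b / n)) + g / n ^ 2 * (a / n) =
      (a * b ^ 2 + b * n ^ 2 + 2 * (a * b * n) + g * a) / n ^ 3 := by
    field_simp
  rw [e, le_div_iff₀ (by positivity)]
  have h1 : 10 ^ 8 * n ^ 2 ≤ n ^ 3 := by nlinarith [sq_nonneg n]
  have h2 : 2 * (a * b) + a + g ≤ 3 * n ^ 2 := by subst hc; nlinarith [mul_nonneg ha hb]
  nlinarith

lemma product_bound {a b : ℝ} (ha : 0 ≤ a) (hb : 0 ≤ b) (hab : a + b ≤ 1)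
    (h1 : 5 / 4 - 2 / 10 ^ 7 ≤ a * b ^ 2 + b + 2 * (a * b) + b ^ 2 * a)
    (h2 : 5 / 4 - 2 / 10 ^ 7 ≤ b * a ^ 2 + a + 2 * (b * a) + a ^ 2 * b) :
    (a - b) ^ 2 ≤ 1 / 10 ^ 6 ∧ 999 / 1000 ≤ a + b := by
  have h3 : 1 / 4 - 1 / 10 ^ 7 * (4 / 6) ≤ a * b := by
    have : a * b * (a + b) ≤ a * b := mul_le_of_le_one_right (mul_nonneg ha hb) hab
    nlinarith
  constructor
  · nlinarith
  · nlinarith [sq_nonneg (a - b)]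

lemma missing_bound {a b g : ℝ} (ha : 0 ≤ a) (hb : 0 ≤ b) (hab : a + b ≤ 1)
    (hd : (a - b) ^ 2 ≤ 1 / 10 ^ 6) (hs : 999 / 1000 ≤ a + b)
    (h : 5 / 4 - 2 / 10 ^ 7 ≤ a * b ^ 2 + b + 2 * (a * b) + g * a) :
    b ^ 2 - g ≤ 1 / 500 := by
  have hd' : |a - b| ≤ 1 / 10 ^ 3 := by
    apply abs_le_of_sq_le_sq _ (by norm_num)
    linarith
  rw [abs_le] at hd'
  have ha' : 499 / 1000 ≤ a := by linarith
  have hb' : b ≤ 5005 / 10000 := by linarith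
  have hp : a * b ≤ 1 / 4 := by nlinarith [sq_nonneg (a - b)]
  have h1 : (b ^ 2 - g) * a ≤ 8 / 10 ^ 4 := by nlinarith
  nlinarith

lemma normalized_sparse {n b g g₁ g₂ : ℝ} (hn : 0 < n)
    (hg : g ^ 2 ≤ 2 * ((b ^ 2 - g₁) + (b ^ 2 - g₂)) * b ^ 2) :
    (g / n ^ 2) ^ 2 ≤
      2 * (((b / n) ^ 2 - g₁ / n ^ 2) + ((b / n) ^ 2 - g₂ / n ^ 2)) * (b / n) ^ 2 := by
  have e : 2 * (((b / n) ^ 2 - g₁ / n ^ 2) + ((b / n) ^ 2 - g₂ / n ^ 2)) * (b / n) ^ 2 =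
      2 * ((b ^ 2 - g₁) + (b ^ 2 - g₂)) * b ^ 2 / (n ^ 2) ^ 2 := by
    field_simp
  rw [e, div_pow]
  gcongr

lemma sparse_bound {b m₁ m₂ g : ℝ} (hb : 0 ≤ b) (hb' : b ≤ 51 / 100)
    (h1 : m₁ ≤ 1 / 500) (h2 : m₂ ≤ 1 / 500) (h : g ^ 2 ≤ 2 * (m₁ + m₂) * b ^ 2) :
    g ≤ 1 / 20 := by
  have hb2 : b ^ 2 ≤ 3 / 10 := by nlinarith
  have : g ^ 2 ≤ (1 / 20) ^ 2 := by nlinarith [sq_nonneg b]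
  exact le_of_abs_le (abs_le_of_sq_le_sq this (by norm_num))

/-- The exceptional vertex cannot have large degree when its link is sparse in both parts. -/
lemma exceptional_contradiction {n a b g₁ g₂ : ℝ} (hn : 0 < n) (ha : 0 ≤ a) (hb : 0 ≤ b)
    (hc : 1 + (a + b) = n) (h1 : g₁ ≤ 1 / 20 * n ^ 2) (h2 : g₂ ≤ 1 / 20 * n ^ 2)
    (h : (5 / 4 - 1 / 10 ^ 7) * n ^ 3 ≤ 3 * (a * b * n) + 3 * n * (g₁ + g₂)) : False := by
  have hprod : a * b ≤ n ^ 2 / 4 := by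
    subst hc
    nlinarith [sq_nonneg (a - b)]
  have hp1 := mul_le_mul_of_nonneg_right hprod hn.le
  have hp2 := mul_le_mul_of_nonneg_left (add_le_add h1 h2) hn.le
  have hn3 : 0 < n ^ 3 := by positivity
  linarith

/-- (ℓ2-vertex-extendability of 𝔽 with respect to bipartite 3-graphs.)
There exist δ > 0 and N₀ such that for every 𝔽-free 3-graph H on n ≥ N₀ vertices with
`δ_{ℓ2}(H) ≥ (5/4 − δ)·n³`: if `H − v` is bipartite for some vertex v, then H is bipartite. -/
theorem fano_l2_vertex_extendable :
    ∃ (δ : ℝ) (N₀ : ℕ), 0 < δ ∧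
      ∀ n : ℕ, N₀ ≤ n → ∀ H : Finset (Finset (Fin n)), Is3Graph H → FanoFree H →
        (∀ v : Fin n, ((5 : ℝ) / 4 - δ) * (n : ℝ) ^ 3 ≤ d2deg H v) →
        (∃ v : Fin n, Bipartite3 (delVert H v)) → Bipartite3 H := by
  refine ⟨1 / 10 ^ 7, 10 ^ 8, by norm_num, ?_⟩
  rintro n hn H hH hF hdeg ⟨v, hv⟩
  by_contra hb
  obtain ⟨A, B, h⟩ := exists_splits hv
  obtain ⟨x, hx, x', hx', hvx⟩ := exists_tri_of_not_bipartite h hH hb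
  obtain ⟨y, hy, y', hy', hvy⟩ := exists_tri_of_not_bipartite h.symm hH hb
  have hnR : (10 : ℝ) ^ 8 ≤ n := by exact_mod_cast hn
  have hn0 : (0 : ℝ) < n := by linarith
  have hc : 1 + ((A.card : ℝ) + B.card) = n := by exact_mod_cast h.card
  have hA0 : (0 : ℝ) ≤ A.card := Nat.cast_nonneg _
  have hB0 : (0 : ℝ) ≤ B.card := Nat.cast_nonneg _
  have norm_part : ∀ {P Q : Finset (Fin n)}, Splits H v P Q → ∀ u ∈ P,
      5 / 4 - 2 / 10 ^ 7 ≤ (P.card : ℝ) / n * (Q.card / n) ^ 2 + Q.card / n +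
        2 * (P.card / n * (Q.card / n)) + linkCount H u Q / (n : ℝ) ^ 2 * (P.card / n) ∧
      (linkCount H u Q : ℝ) / (n : ℝ) ^ 2 ≤ (Q.card / n) ^ 2 := by
    intro P Q hPQ u hu
    have hl : (linkCount H u Q : ℝ) ≤ (Q.card : ℝ) ^ 2 := by
      exact_mod_cast Splits.linkCount_le (H := H) (B := Q) u
    refine ⟨normalized_bound hnR (Nat.cast_nonneg _) (Nat.cast_nonneg _)
      (by exact_mod_cast hPQ.card) hl ?_, ?_⟩
    · refine (hdeg u).trans ((d2deg_le hH u).trans ?_)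
      exact_mod_cast hPQ.degree_le hu
    · rw [div_pow]
      gcongr
  obtain ⟨x1, x2⟩ := norm_part h x hx
  obtain ⟨x1', -⟩ := norm_part h x' hx'
  obtain ⟨y1, y2⟩ := norm_part h.symm y hy
  obtain ⟨y1', -⟩ := norm_part h.symm y' hy'
  have hFx := h.linkCount_sq_le hH hF hx hx' hvx
  have hFy := h.symm.linkCount_sq_le hH hF hy hy' hvy
  have hv1 : ((5 : ℝ) / 4 - 1 / 10 ^ 7) * (n : ℝ) ^ 3 ≤ 3 * (A.card * B.card * n) +
      3 * n * (linkCount H v A + linkCount H v B) := by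
    refine (hdeg v).trans ((d2deg_le hH v).trans ?_)
    exact_mod_cast h.degree_exceptional_le hH
  set α : ℝ := A.card / n with hα
  set β : ℝ := B.card / n with hβ
  have hα0 : 0 ≤ α := by positivity
  have hβ0 : 0 ≤ β := by positivity
  have hαβ : α + β ≤ 1 := by
    rw [hα, hβ, ← add_div, div_le_one hn0]
    linarith
  obtain ⟨hd, hs⟩ := product_bound hα0 hβ0 hαβ
    (x1.trans (by gcongr)) (y1.trans (by gcongr))
  have hd' : (β - α) ^ 2 ≤ 1 / 10 ^ 6 := by nlinarith
  have hdabs : |α - β| ≤ 1 / 10 ^ 3 := abs_le_of_sq_le_sq (by linarith) (by norm_num)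
  rw [abs_le] at hdabs
  have gB := sparse_bound hβ0 (by linarith) (missing_bound hα0 hβ0 hαβ hd hs x1)
    (missing_bound hα0 hβ0 hαβ hd hs x1') (normalized_sparse hn0 hFx)
  have gA := sparse_bound hα0 (by linarith)
    (missing_bound hβ0 hα0 (by linarith) hd' (by linarith) y1)
    (missing_bound hβ0 hα0 (by linarith) hd' (by linarith) y1') (normalized_sparse hn0 hFy)
  rw [div_le_iff₀ (by positivity)] at gA gB
  exact exceptional_contradiction hn0 hA0 hB0 hc gA gB hv1
end
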